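/- Let g, h : F(Σ) → F(Δ) be injective homomorphisms between finitely generated free groups such that both im(g) and im(h) are retracts of ⟨im(g) ∪ im(h)⟩ and im(g) ≠ im(h). Then rk(Eq(g,h)) < |Σ|. -/

import Mathlib

/-- `rkLe H n` : the (free) subgroup `H` has rank at most `n`. -/
def rkLe {G : Type*} [Group G] (H : Subgroup G) (n : ℕ) : Prop :=
  ∃ S : Finset G, S.card ≤ n ∧ Subgroup.closure (S : Set G) = H

/-- `A` is a retract of the subgroup `B` (for `A ≤ B`). -/
def IsRetractIn {G : Type*} [Group G] (A B : Subgroup G) : Prop :=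
  ∃ ρ : ↥B →* G, (∀ x, ρ x ∈ A) ∧ ∀ x : ↥B, (x : G) ∈ A → ρ x = x

section
open scoped ENNReal
open Filter Topology

namespace S16

/-- real square-summable functions -/
def L2 (X : Type*) : Type _ := ↥(lp (fun _ : X => ℝ) 2)

noncomputable section
open Classical

instance {X : Type*} : NormedAddCommGroup (L2 X) :=
  inferInstanceAs (NormedAddCommGroup (lp (fun _ : X => ℝ) 2))
instance {X : Type*} : InnerProductSpace ℝ (L2 X) :=
  inferInstanceAs (InnerProductSpace ℝ (lp (fun _ : X => ℝ) 2))
instance {X : Type*} : CompleteSpace (L2 X) :=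
  inferInstanceAs (CompleteSpace (lp (fun _ : X => ℝ) 2))
/-- values -/
def L2.val {X : Type*} (u : L2 X) : X → ℝ := fun x => (show lp (fun _ : X => ℝ) 2 from u).1 x
instance {X : Type*} : CoeFun (L2 X) (fun _ => X → ℝ) := ⟨L2.val⟩

@[ext] lemma L2.ext {X : Type*} {u v : L2 X} (h : ∀ x, u x = v x) : u = v :=
  Subtype.ext (funext h)
@[simp] lemma L2.add_apply {X : Type*} (u v : L2 X) (x : X) : (u + v) x = u x + v x := rfl
@[simp] lemma L2.sub_apply {X : Type*} (u v : L2 X) (x : X) : (u - v) x = u x - v x := rfl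
@[simp] lemma L2.neg_apply {X : Type*} (u : L2 X) (x : X) : (-u) x = -u x := rfl
@[simp] lemma L2.smul_apply {X : Type*} (c : ℝ) (u : L2 X) (x : X) : (c • u) x = c * u x := rfl
@[simp] lemma L2.zero_apply {X : Type*} (x : X) : (0 : L2 X) x = 0 := rfl

lemma memL2_iff {X : Type*} (u : X → ℝ) : Memℓp u 2 ↔ Summable (fun x => u x ^ 2) := by
  rw [memℓp_gen_iff (by simp)]
  simp

/-- constructor -/
def L2.mk {X : Type*} (u : X → ℝ) (hu : Summable (fun x => u x ^ 2)) : L2 X :=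
  ⟨u, (memL2_iff u).2 hu⟩

@[simp] lemma L2.mk_apply {X : Type*} (u : X → ℝ) (hu : Summable (fun x => u x ^ 2)) (x : X) :
    L2.mk u hu x = u x := rfl

/-- delta function -/
def dl {X : Type*} (x : X) : L2 X := (lp.single 2 x (1 : ℝ) : lp (fun _ : X => ℝ) 2)

lemma inner_dl {X : Type*} (x : X) (u : L2 X) : inner ℝ (dl x) u = u x := by
  have := lp.inner_single_left (𝕜 := ℝ) (G := fun _ : X => ℝ) x 1 u
  simp at this
  exact this

lemma inner_dl' {X : Type*} (x : X) (u : L2 X) : inner ℝ u (dl x) = u x := by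
  rw [real_inner_comm, inner_dl]

lemma dl_apply {X : Type*} (x y : X) : (dl x : L2 X) y = if y = x then 1 else 0 := by
  have := lp.single_apply (E := fun _ : X => ℝ) 2 x 1 y
  rw [Pi.single_apply] at this
  exact this

lemma L2.summable {X : Type*} (u : L2 X) : Summable (fun x => u x ^ 2) :=
  (memL2_iff _).1 (lp.memℓp (show lp (fun _ : X => ℝ) 2 from u))

lemma L2.hasSum_inner {X : Type*} (u v : L2 X) : HasSum (fun x => u x * v x) (inner ℝ u v) := by
  have := lp.hasSum_inner (𝕜 := ℝ) (G := fun _ : X => ℝ) u v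
  have e : (fun x => u x * v x) = fun i => inner ℝ (u i) (v i) := by
    funext i; simp [mul_comm]
  rw [e]; exact this

lemma L2.inner_eq {X : Type*} (u v : L2 X) : inner ℝ u v = ∑' x, u x * v x :=
  (L2.hasSum_inner u v).tsum_eq.symm

lemma L2.norm_sq {X : Type*} (u : L2 X) : ‖u‖ ^ 2 = ∑' x, u x ^ 2 := by
  rw [← real_inner_self_eq_norm_sq, L2.inner_eq]
  simp [sq]

/-- pull back along an injective map -/
def pb {X Y : Type*} (φ : X → Y) (hφ : Function.Injective φ) : L2 Y →L[ℝ] L2 X :=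
  LinearMap.mkContinuous
    { toFun := fun u => L2.mk (fun x => u (φ x)) ((L2.summable u).comp_injective hφ)
      map_add' := fun u v => by ext x; rfl
      map_smul' := fun c u => by ext x; rfl } 1 (fun u => by
      rw [one_mul]
      refine (pow_le_pow_iff_left₀ (norm_nonneg _) (norm_nonneg _) two_ne_zero).1 ?_
      rw [L2.norm_sq, L2.norm_sq]
      exact (tsum_comp_le_tsum_of_inj (L2.summable u) (fun x => sq_nonneg _) hφ))

@[simp] lemma pb_apply {X Y : Type*} (φ : X → Y) (hφ : Function.Injective φ) (u : L2 Y) (x : X) :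
    pb φ hφ u x = u (φ x) := rfl

/-- push forward along an injective map -/
def pf {X Y : Type*} (φ : X → Y) (hφ : Function.Injective φ) : L2 X →L[ℝ] L2 Y :=
  ContinuousLinearMap.adjoint (pb φ hφ)

lemma pf_apply {X Y : Type*} (φ : X → Y) (hφ : Function.Injective φ) (u : L2 X) (y : Y) :
    pf φ hφ u y = inner ℝ u (pb φ hφ (dl y)) := by
  rw [← inner_dl', pf, ContinuousLinearMap.adjoint_inner_left]

lemma pb_dl {X Y : Type*} (φ : X → Y) (hφ : Function.Injective φ) (x : X) :
    pb φ hφ (dl (φ x)) = dl x := by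
  ext z
  rw [pb_apply, dl_apply, dl_apply]
  simp [hφ.eq_iff]

lemma pb_dl_of_notMem {X Y : Type*} (φ : X → Y) (hφ : Function.Injective φ) (y : Y)
    (hy : y ∉ Set.range φ) : pb φ hφ (dl y) = 0 := by
  ext z
  rw [pb_apply, dl_apply, if_neg]
  · rfl
  · rintro rfl; exact hy ⟨z, rfl⟩

@[simp] lemma pf_apply_map {X Y : Type*} (φ : X → Y) (hφ : Function.Injective φ) (u : L2 X) (x : X) :
    pf φ hφ u (φ x) = u x := by
  rw [pf_apply, pb_dl, inner_dl']

lemma pf_apply_of_notMem {X Y : Type*} (φ : X → Y) (hφ : Function.Injective φ) (u : L2 X) (y : Y)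
    (hy : y ∉ Set.range φ) : pf φ hφ u y = 0 := by
  rw [pf_apply, pb_dl_of_notMem _ _ _ hy, inner_zero_right]

lemma pf_dl {X Y : Type*} (φ : X → Y) (hφ : Function.Injective φ) (x : X) :
    pf φ hφ (dl x) = dl (φ x) := by
  ext y
  by_cases hy : y ∈ Set.range φ
  · obtain ⟨z, rfl⟩ := hy
    rw [pf_apply_map, dl_apply, dl_apply]; simp [hφ.eq_iff]
  · rw [pf_apply_of_notMem _ _ _ _ hy, dl_apply, if_neg]
    rintro rfl; exact hy ⟨x, rfl⟩

/-- left translation of the index set -/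
def lt (ι : Type*) {G : Type*} [Group G] (g : G) : ι × G → ι × G := fun q => (q.1, g * q.2)

lemma lt_inj (ι : Type*) {G : Type*} [Group G] (g : G) : Function.Injective (lt ι g) := by
  rintro ⟨a, b⟩ ⟨c, d⟩ h
  simp only [lt, Prod.mk.injEq, mul_right_inj] at h
  ext <;> simp [h]

/-- left translation operator -/
def LT (ι : Type*) {G : Type*} [Group G] (g : G) : L2 (ι × G) →L[ℝ] L2 (ι × G) :=
  pb (lt ι g) (lt_inj ι g)

lemma LT_apply (ι : Type*) {G : Type*} [Group G] (g : G) (u : L2 (ι × G)) (i : ι) (z : G) :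
    LT ι g u (i, z) = u (i, g * z) := rfl

lemma LT_dl (ι : Type*) {G : Type*} [Group G] (g : G) (i : ι) (z : G) :
    LT ι g (dl (i, z)) = dl (i, g⁻¹ * z) := by
  ext ⟨j, y⟩
  rw [LT_apply, dl_apply, dl_apply]
  simp only [Prod.mk.injEq, eq_inv_mul_iff_mul_eq]

lemma LT_inner (ι : Type*) {G : Type*} [Group G] (g : G) (u v : L2 (ι × G)) :
    inner ℝ (LT ι g u) v = inner ℝ u (LT ι g⁻¹ v) := by
  rw [L2.inner_eq, L2.inner_eq]
  have e : (ι × G) ≃ (ι × G) := Equiv.refl _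
  rw [← (Equiv.prodCongr (Equiv.refl ι) (Equiv.mulLeft g⁻¹)).tsum_eq
    (fun x => (LT ι g u) x * v x)]
  refine tsum_congr ?_
  rintro ⟨i, z⟩
  simp [LT_apply]

/-- equivariant operators -/
def Eqv {ι κ G : Type*} [Group G] (T : L2 (ι × G) →L[ℝ] L2 (κ × G)) : Prop :=
  ∀ g u, T (LT ι g u) = LT κ g (T u)

lemma Eqv.adjoint {ι κ G : Type*} [Group G] {T : L2 (ι × G) →L[ℝ] L2 (κ × G)} (hT : Eqv T) :
    Eqv (ContinuousLinearMap.adjoint T) := by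
  intro g u
  refine ext_inner_right ℝ fun v => ?_
  rw [ContinuousLinearMap.adjoint_inner_left, LT_inner, LT_inner,
    ContinuousLinearMap.adjoint_inner_left, hT]

lemma Eqv.comp {ι κ μ G : Type*} [Group G] {T : L2 (ι × G) →L[ℝ] L2 (κ × G)}
    {S : L2 (κ × G) →L[ℝ] L2 (μ × G)} (hS : Eqv S) (hT : Eqv T) : Eqv (S ∘L T) := by
  intro g u
  simp [hT g, hS g]

lemma Eqv.one {ι G : Type*} [Group G] : Eqv (1 : L2 (ι × G) →L[ℝ] L2 (ι × G)) := by
  intro g u; rfl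

lemma Eqv.sub {ι κ G : Type*} [Group G] {S T : L2 (ι × G) →L[ℝ] L2 (κ × G)} (hS : Eqv S)
    (hT : Eqv T) : Eqv (S - T) := by
  intro g u; simp [hS g, hT g]

lemma Eqv.smul {ι κ G : Type*} [Group G] {T : L2 (ι × G) →L[ℝ] L2 (κ × G)} (c : ℝ)
    (hT : Eqv T) : Eqv (c • T) := by
  intro g u; simp [hT g]

lemma Eqv.pow {ι G : Type*} [Group G] {T : L2 (ι × G) →L[ℝ] L2 (ι × G)}
    (hT : Eqv T) (n : ℕ) : Eqv (T ^ n) := by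
  induction n with
  | zero => exact Eqv.one
  | succ n ih => rw [pow_succ]; exact ih.comp hT

lemma Eqv.flip {ι κ G : Type*} [Group G] {T : L2 (ι × G) →L[ℝ] L2 (κ × G)} (hT : Eqv T)
    (i : ι) (k : κ) (z : G) :
    T (dl (i, 1)) (k, z) = (ContinuousLinearMap.adjoint T) (dl (k, 1)) (i, z⁻¹) := by
  have h1 : (dl (i, z⁻¹) : L2 (ι × G)) = LT ι z (dl (i, 1)) := by rw [LT_dl]; simp
  rw [← inner_dl' (i, z⁻¹), ContinuousLinearMap.adjoint_inner_left, h1, hT, inner_dl, LT_apply]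
  simp

/-- trace -/
def tau {ι G : Type*} [Group G] [Fintype ι] (T : L2 (ι × G) →L[ℝ] L2 (ι × G)) : ℝ :=
  ∑ i, inner ℝ (T (dl (i, 1))) (dl (i, 1))

lemma tau_key {ι κ G : Type*} [Group G]
    (A : L2 (κ × G) →L[ℝ] L2 (ι × G)) (B : L2 (ι × G) →L[ℝ] L2 (κ × G)) (i : ι) :
      HasSum (fun q : κ × G => B (dl (i, 1)) q * ContinuousLinearMap.adjoint A (dl (i, 1)) q)
      (inner ℝ ((A ∘L B) (dl (i, 1))) (dl (i, 1))) := by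
  rw [ContinuousLinearMap.comp_apply, ← ContinuousLinearMap.adjoint_inner_right]
  exact L2.hasSum_inner _ _

lemma tau_sub {ι G : Type*} [Group G] [Fintype ι] (A B : L2 (ι × G) →L[ℝ] L2 (ι × G)) :
      tau (A - B) = tau A - tau B := by
    simp [tau, inner_sub_left]

lemma tau_one {ι G : Type*} [Group G] [Fintype ι] :
    tau (1 : L2 (ι × G) →L[ℝ] L2 (ι × G)) = Fintype.card ι := by
  simp only [tau, one_apply_eq_self, inner_dl, dl_apply]
  simp

lemma tau_swap {ι κ G : Type*} [Group G] [Fintype ι] [Fintype κ]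
    {A : L2 (κ × G) →L[ℝ] L2 (ι × G)} {B : L2 (ι × G) →L[ℝ] L2 (κ × G)} (hA : Eqv A) (hB : Eqv B) :
    tau (A ∘L B) = tau (B ∘L A) := by
  unfold tau
  have k1 : ∀ i : ι, HasSum (fun z : G => ∑ k : κ, B (dl (i, 1)) (k, z) *
      ContinuousLinearMap.adjoint A (dl (i, 1)) (k, z))
      (inner ℝ ((A ∘L B) (dl (i, 1))) (dl (i, 1))) := by
    intro i
    have h := (Equiv.prodComm G κ).hasSum_iff.2 (tau_key A B i)
    exact h.prod_fiberwise (fun z => hasSum_fintype _)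
  have k2 : ∀ i : κ, HasSum (fun z : G => ∑ k : ι, A (dl (i, 1)) (k, z) *
      ContinuousLinearMap.adjoint B (dl (i, 1)) (k, z))
      (inner ℝ ((B ∘L A) (dl (i, 1))) (dl (i, 1))) := by
    intro i
    have h := (Equiv.prodComm G ι).hasSum_iff.2 (tau_key B A i)
    exact h.prod_fiberwise (fun z => hasSum_fintype _)
  have s1 := hasSum_sum (s := Finset.univ) (fun i _ => k1 i)
  have s2 := hasSum_sum (s := Finset.univ) (fun i _ => k2 i)
  have s3 := (Equiv.inv G).hasSum_iff.2 s2
  refine s1.unique ?_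
  convert! s3 using 1
  funext z
  simp only [Function.comp, Equiv.inv_apply]
  rw [Finset.sum_comm]
  refine Finset.sum_congr rfl fun k _ => Finset.sum_congr rfl fun i _ => ?_
  rw [hB.flip i k z, hA.flip k i z⁻¹, inv_inv, mul_comm]

set_option maxHeartbeats 1000000 in
open ContinuousLinearMap in
lemma tau_pow {ι κ G : Type*} [Group G] [Fintype ι] [Fintype κ]
    {T : L2 (ι × G) →L[ℝ] L2 (κ × G)} (hT : Eqv T) (s : ℕ) :
    tau ((1 - adjoint T ∘L T) ^ s) - Fintype.card ι = tau ((1 - T ∘L adjoint T) ^ s)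
      - Fintype.card κ := by
  have comm : ∀ s : ℕ, ((1 - adjoint T ∘L T) ^ s) ∘L adjoint T = adjoint T ∘L ((1 - T ∘L adjoint T) ^ s) := by
    intro s
    induction s with
    | zero => ext; simp
    | succ n ih =>
      have e : (1 - adjoint T ∘L T) ∘L adjoint T = adjoint T ∘L (1 - T ∘L adjoint T) := by
        ext; simp
      calc ((1 - adjoint T ∘L T) ^ (n+1)) ∘L adjoint T
          = ((1 - adjoint T ∘L T) ^ n) ∘L ((1 - adjoint T ∘L T) ∘L adjoint T) := by
            rw [pow_succ]; rfl
        _ = (((1 - adjoint T ∘L T) ^ n) ∘L adjoint T) ∘L (1 - T ∘L adjoint T) := by rw [e]; rfl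
        _ = adjoint T ∘L ((1 - T ∘L adjoint T) ^ (n+1)) := by rw [ih, pow_succ]; rfl
  induction s with
  | zero =>
    simp only [pow_zero, tau_one, sub_self]
  | succ n ih =>
    have e1 : (1 - adjoint T ∘L T) ^ (n+1) = (1 - adjoint T ∘L T) ^ n -
        (((1 - adjoint T ∘L T) ^ n) ∘L adjoint T) ∘L T := by
      rw [pow_succ, mul_sub, mul_one]; rfl
    have e2 : (1 - T ∘L adjoint T) ^ (n+1) = (1 - T ∘L adjoint T) ^ n -
        T ∘L (adjoint T ∘L ((1 - T ∘L adjoint T) ^ n)) := by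
      rw [pow_succ', sub_mul, one_mul]; rfl
    rw [e1, e2, tau_sub, tau_sub, comm]
    have hE1 : Eqv (T ∘L adjoint T) := Eqv.comp hT hT.adjoint
    have hE2 : Eqv (1 - T ∘L adjoint T) := Eqv.sub Eqv.one hE1
    have hE0 : Eqv (ι := κ) (κ := κ) (G := G) ((1 - T ∘L adjoint T) ^ n) := Eqv.pow hE2 n
    have hE : Eqv (ι := κ) (κ := ι) (G := G) (adjoint T ∘L ((1 - T ∘L adjoint T) ^ n)) :=
      Eqv.comp (ι := κ) (κ := κ) (μ := ι) (S := adjoint T) (T := (1 - T ∘L adjoint T) ^ n)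
        hT.adjoint hE0
    rw [tau_swap hE hT]
    linarith

section hilbert
variable {E F : Type*} [NormedAddCommGroup E] [InnerProductSpace ℝ E] [CompleteSpace E]
  [NormedAddCommGroup F] [InnerProductSpace ℝ F] [CompleteSpace F]
open ContinuousLinearMap

lemma contr_sq (T : E →L[ℝ] F) (hT : ‖T‖ ≤ 1) (v : E) :
    ‖(1 - adjoint T ∘L T) v‖ ^ 2 ≤ ‖v‖ ^ 2 - ‖T v‖ ^ 2 := by
  have h1 : (1 - adjoint T ∘L T) v = v - adjoint T (T v) := rfl
  rw [h1, norm_sub_sq_real, adjoint_inner_right, real_inner_self_eq_norm_sq]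
  have h2 : ‖adjoint T (T v)‖ ≤ ‖T v‖ := by
    refine (le_opNorm _ _).trans ?_
    rw [LinearIsometryEquiv.norm_map]
    exact mul_le_of_le_one_left (norm_nonneg _) hT
  have h3 : ‖adjoint T (T v)‖ ^ 2 ≤ ‖T v‖ ^ 2 := by gcongr
  linarith

lemma contr_norm (T : E →L[ℝ] F) (hT : ‖T‖ ≤ 1) (v : E) :
    ‖(1 - adjoint T ∘L T) v‖ ≤ ‖v‖ := by
  have := contr_sq T hT v
  refine (pow_le_pow_iff_left₀ (norm_nonneg _) (norm_nonneg _) two_ne_zero).1 ?_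
  nlinarith [sq_nonneg ‖T v‖]

lemma selfadj (T : E →L[ℝ] F) (u v : E) :
    inner ℝ ((1 - adjoint T ∘L T) u) v = inner ℝ u ((1 - adjoint T ∘L T) v) := by
  have h1 : ∀ v, (1 - adjoint T ∘L T) v = v - adjoint T (T v) := fun _ => rfl
  rw [h1, h1, inner_sub_left, inner_sub_right, adjoint_inner_left, adjoint_inner_right]

lemma selfadj_pow (T : E →L[ℝ] F) (n : ℕ) (u v : E) :
    inner ℝ (((1 - adjoint T ∘L T) ^ n) u) v = inner ℝ u (((1 - adjoint T ∘L T) ^ n) v) := by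
  induction n generalizing u v with
  | zero => simp
  | succ n ih =>
    nth_rw 1 [pow_succ]
    rw [pow_succ']
    change inner ℝ (((1 - adjoint T ∘L T) ^ n) ((1 - adjoint T ∘L T) u)) v =
      inner ℝ u ((1 - adjoint T ∘L T) (((1 - adjoint T ∘L T) ^ n) v))
    rw [ih, selfadj]

lemma pow_norm_sq (T : E →L[ℝ] F) (n : ℕ) (u : E) :
    inner ℝ (((1 - adjoint T ∘L T) ^ (2 * n)) u) u = ‖((1 - adjoint T ∘L T) ^ n) u‖ ^ 2 := by
  rw [two_mul, pow_add, ← real_inner_self_eq_norm_sq, selfadj_pow]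
  change inner ℝ (((1 - adjoint T ∘L T) ^ n) (((1 - adjoint T ∘L T) ^ n) u)) u = _
  rw [selfadj_pow, selfadj_pow]

lemma pow_tendsto (T : E →L[ℝ] F) (hT : ‖T‖ ≤ 1) (inj : ∀ v, T v = 0 → v = 0) (u : E) :
    Tendsto (fun n : ℕ => inner ℝ (((1 - adjoint T ∘L T) ^ (2 * n)) u) u) atTop (𝓝 0) := by
  set A := (1 - adjoint T ∘L T) with hA
  have hA1 : ‖A ^ 2‖ ≤ 1 := by
    refine opNorm_le_bound _ zero_le_one fun v => ?_
    rw [one_mul, pow_two]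
    exact (contr_norm T hT _).trans (contr_norm T hT _)
  have fix : ∀ v, (A ^ 2) v = v → v = 0 := by
    intro v hv
    apply inj
    have h1 := contr_sq T hT v
    have h2 : ‖v‖ ≤ ‖A v‖ := by
      conv_lhs => rw [← hv, pow_two]
      exact contr_norm T hT _
    have h3 : ‖v‖ ^ 2 ≤ ‖A v‖ ^ 2 := by gcongr
    have : ‖T v‖ ^ 2 ≤ 0 := by linarith
    have : ‖T v‖ = 0 := by nlinarith [norm_nonneg (T v), sq_nonneg ‖T v‖]
    exact norm_eq_zero.1 this
  have mean := ContinuousLinearMap.tendsto_birkhoffAverage_orthogonalProjection (𝕜 := ℝ) (A ^ 2) hA1 u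
  have z : ∀ w : ((A^2).eqLocus (1 : E →L[ℝ] E)), (w : E) = 0 := fun w => fix _ w.2
  rw [z] at mean
  have mean2 := mean.inner (𝕜 := ℝ) (tendsto_const_nhds (x := u))
  rw [inner_zero_left] at mean2
  have dec : Antitone (fun n : ℕ => ‖(A ^ n) u‖) := by
    refine antitone_nat_of_succ_le fun n => ?_
    rw [pow_succ']
    exact contr_norm T hT _
  have iter : ∀ n : ℕ, (⇑(A ^ 2))^[n] u = (A ^ (2 * n)) u := by
    intro n
    rw [pow_mul]
    generalize A ^ 2 = B
    induction n with
    | zero => rfl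
    | succ n ih => rw [Function.iterate_succ_apply', ih, pow_succ']; rfl
  refine tendsto_of_tendsto_of_tendsto_of_le_of_le' tendsto_const_nhds mean2 ?_ ?_
  · refine Eventually.of_forall fun n => ?_
    rw [pow_norm_sq]; positivity
  · filter_upwards [eventually_gt_atTop 0] with n hn
    rw [birkhoffAverage, birkhoffSum, inner_smul_left, sum_inner]
    have hn' : (0 : ℝ) < n := by exact_mod_cast hn
    rw [RCLike.conj_to_real, inv_mul_eq_div, le_div_iff₀ hn', pow_norm_sq]
    calc ‖(A ^ n) u‖ ^ 2 * n = ∑ k ∈ Finset.range n, ‖(A ^ n) u‖ ^ 2 := by simp [mul_comm]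
      _ ≤ _ := by
        refine Finset.sum_le_sum fun k hk => ?_
        rw [id, iter, pow_norm_sq]
        have := dec (Finset.mem_range.1 hk).le
        dsimp only at this
        gcongr
end hilbert

open ContinuousLinearMap

/-- the swap lemma -/
theorem swap_aux {ι κ G : Type*} [Group G] [Fintype ι] [Fintype κ]
    {T : L2 (ι × G) →L[ℝ] L2 (κ × G)} (hT : Eqv T) (hn : ‖T‖ ≤ 1) (inj : ∀ v, T v = 0 → v = 0) :
    Fintype.card ι ≤ Fintype.card κ ∧
    (Fintype.card ι = Fintype.card κ → ∀ v, adjoint T v = 0 → v = 0) := by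
  have t1 : Tendsto (fun n : ℕ => tau ((1 - adjoint T ∘L T) ^ (2 * n))) atTop (𝓝 0) := by
    unfold tau
    have := tendsto_finsetSum (Finset.univ : Finset ι) (fun i _ => pow_tendsto T hn inj (dl (i, 1)))
    simpa using this
  have t2 : Tendsto (fun n : ℕ => tau ((1 - T ∘L adjoint T) ^ (2 * n))) atTop
      (𝓝 ((Fintype.card κ : ℝ) - Fintype.card ι)) := by
    have := (t1.sub_const (Fintype.card ι : ℝ)).add_const (Fintype.card κ : ℝ)
    convert! this using 1
    · funext n
      rw [tau_pow hT]; ring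
    · congr 1; ring
  have e0 : ∀ (n : ℕ) (k : κ), 
      inner ℝ (((1 - T ∘L adjoint T) ^ (2 * n)) (dl (k, (1:G)))) (dl (k, 1)) =
        ‖((1 - T ∘L adjoint T) ^ n) (dl (k, (1:G)))‖ ^ 2 := by
    intro n k
    have := pow_norm_sq (adjoint T) n (dl (k, (1:G)))
    rwa [adjoint_adjoint] at this
  constructor
  · have : (0:ℝ) ≤ (Fintype.card κ : ℝ) - Fintype.card ι := by
      refine ge_of_tendsto' t2 fun n => ?_
      unfold tau
      refine Finset.sum_nonneg fun k _ => ?_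
      rw [e0]; positivity
    have : (Fintype.card ι : ℝ) ≤ Fintype.card κ := by linarith
    exact_mod_cast this
  · intro hc v hv
    rw [hc, sub_self] at t2
    have one : ∀ w, adjoint T w = 0 → ∀ k : κ, w (k, 1) = 0 := by
      intro w hw k
      have b : ∀ n : ℕ, (w (k, 1)) ^ 2 ≤ ‖w‖ ^ 2 * tau ((1 - T ∘L adjoint T) ^ (2 * n)) := by
        intro n
        have fixw : ((1 - T ∘L adjoint T) ^ n) w = w := by
          induction n with
          | zero => rfl
          | succ n ih =>
            rw [pow_succ]
            change ((1 - T ∘L adjoint T) ^ n) ((1 - T ∘L adjoint T) w) = w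
            have : (1 - T ∘L adjoint T) w = w := by
              change w - T (adjoint T w) = w
              rw [hw]; simp
            rw [this, ih]
        have sa := selfadj_pow (adjoint T) n w (dl (k, (1:G)))
        rw [adjoint_adjoint] at sa
        rw [fixw, inner_dl'] at sa
        rw [sa]
        calc (inner ℝ w (((1 - T ∘L adjoint T) ^ n) (dl (k, 1)))) ^ 2 
            ≤ (‖w‖ * ‖((1 - T ∘L adjoint T) ^ n) (dl (k, (1:G)))‖) ^ 2 := by
              rw [sq_le_sq, abs_of_nonneg (a := ‖w‖ * _) (by positivity)]
              exact abs_real_inner_le_norm _ _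
          _ = ‖w‖ ^ 2 * ‖((1 - T ∘L adjoint T) ^ n) (dl (k, (1:G)))‖ ^ 2 := by ring
          _ ≤ _ := by
            gcongr
            rw [← e0]
            unfold tau
            refine Finset.single_le_sum (f := fun k => inner ℝ (((1 - T ∘L adjoint T) ^ (2 * n)) (dl (k, (1:G)))) (dl (k, 1))) (fun j _ => ?_) (Finset.mem_univ k)
            rw [e0]; positivity
      have : (w (k, 1)) ^ 2 ≤ ‖w‖ ^ 2 * 0 := ge_of_tendsto' (t2.const_mul _) b
      nlinarith [sq_nonneg (w (k, 1))]
    ext ⟨k, z⟩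
    have := one (LT κ z v) (by rw [hT.adjoint, hv, map_zero]) k
    rw [LT_apply, mul_one] at this
    rw [this]; rfl

theorem swap {ι κ G : Type*} [Group G] [Fintype ι] [Fintype κ]
    {T : L2 (ι × G) →L[ℝ] L2 (κ × G)} (hT : Eqv T) (inj : ∀ v, T v = 0 → v = 0) :
    Fintype.card ι ≤ Fintype.card κ ∧
    (Fintype.card ι = Fintype.card κ → ∀ v, adjoint T v = 0 → v = 0) := by
  set c : ℝ := (‖T‖ + 1)⁻¹ with hc
  have cpos : 0 < c := by positivity
  have h := swap_aux (hT.smul c) (by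
      rw [norm_smul, Real.norm_of_nonneg cpos.le, hc, inv_mul_le_iff₀ (by positivity)]
      linarith) (fun v hv => inj v (by
      rw [smul_apply] at hv
      exact (smul_eq_zero.1 hv).resolve_left cpos.ne'))
  refine ⟨h.1, fun e v hv => h.2 e v ?_⟩
  rw [map_smulₛₗ]
  simp [hv]
end

end S16
end

section
namespace S16

lemma unip_pow {R : Type*} [Ring R] (x : R) (m N : ℕ) (hx : x ^ m = 0) (h2 : (2 : R) ^ N = 0) :
    (x + 1) ^ (2 ^ (N + m)) = 1 := by
  rw [(Commute.one_right x).add_pow, Finset.sum_eq_single 0]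
  · simp
  · intro i hi hi0
    by_cases him : m ≤ i
    · have : x ^ i = 0 := by
        rw [← Nat.add_sub_cancel' him, pow_add, hx, zero_mul]
      rw [this]; simp
    · push Not at him
      have hle : i ≤ 2 ^ (N + m) := by
        have := Finset.mem_range.1 hi; omega
      have hf := Nat.factorization_choose_prime_pow Nat.prime_two hle hi0
      have hlt := Nat.factorization_lt 2 hi0
      have hd : 2 ^ N ∣ (2 ^ (N + m)).choose i := by
        rw [Nat.prime_two.pow_dvd_iff_le_factorization (Nat.choose_pos hle).ne', hf]
        omega
      obtain ⟨c, hc⟩ := hd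
      rw [hc]
      push_cast
      rw [h2]; simp
  · intro h; simp at h

/-- upper unitriangular -/
def Uni {R : Type*} [Ring R] {n : ℕ} (M : Matrix (Fin n) (Fin n) R) : Prop :=
  ∀ i j, j ≤ i → M i j = if i = j then 1 else 0

lemma Uni.mul {R : Type*} [Ring R] {n : ℕ} {M N : Matrix (Fin n) (Fin n) R} (hM : Uni M)
    (hN : Uni N) : Uni (M * N) := by
  intro i j hij
  rw [Matrix.mul_apply, Finset.sum_eq_single i]
  · rw [hM i i le_rfl, hN i j hij]; simp
  · intro k _ hk
    rcases lt_or_gt_of_ne hk with h | h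
    · rw [hM i k h.le, if_neg h.ne']; simp
    · rw [hN k j (hij.trans h.le), if_neg (hij.trans_lt h).ne']; simp
  · simp

lemma Uni.pow_sub {R : Type*} [Ring R] {n : ℕ} {M : Matrix (Fin n) (Fin n) R} (hM : Uni M) :
    (M - 1) ^ n = 0 := by
  have key : ∀ k : ℕ, ∀ i j : Fin n, (j : ℕ) < i + k → ((M - 1) ^ k) i j = 0 := by
    intro k
    induction k with
    | zero =>
      intro i j h
      rw [pow_zero, Matrix.one_apply_ne]
      rintro rfl; omega
    | succ k ih =>
      intro i j h
      rw [pow_succ, Matrix.mul_apply]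
      refine Finset.sum_eq_zero fun l _ => ?_
      by_cases hl : (l : ℕ) < i + k
      · rw [ih i l hl, zero_mul]
      · have hjl : j ≤ l := by
          rw [Fin.le_def]; omega
        rw [Matrix.sub_apply, hM l j hjl, Matrix.one_apply]; simp
  ext i j
  rw [key n i j (by omega)]; rfl

noncomputable section
open Classical
variable {κ : Type*}

/-- the elementary nilpotent matrices -/
def Xm (R : Type*) [Ring R] (s : ℕ) (idx : ℕ → Option κ) (i : κ) :
    Matrix (Fin (s+1)) (Fin (s+1)) R :=
  Matrix.of fun a b => if (b : ℕ) = a + 1 ∧ idx a = some i then 1 else 0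

lemma Xm_sq (R : Type*) [Ring R] (s : ℕ) (idx : ℕ → Option κ)
    (h : ∀ j i, idx j = some i → idx (j+1) ≠ some i) (i : κ) :
    Xm R s idx i * Xm R s idx i = 0 := by
  ext a b
  rw [Matrix.mul_apply]
  refine Finset.sum_eq_zero fun c _ => ?_
  simp only [Xm, Matrix.of_apply]
  by_cases h1 : (c : ℕ) = a + 1 ∧ idx a = some i
  · rw [if_neg (c := (b : ℕ) = c + 1 ∧ idx c = some i)]
    · simp
    · rintro ⟨-, h2⟩
      rw [h1.1] at h2
      exact h _ _ h1.2 h2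
  · rw [if_neg h1]; simp

/-- the generator matrices -/
def Um (R : Type*) [Ring R] (s : ℕ) (idx : ℕ → Option κ)
    (h : ∀ j i, idx j = some i → idx (j+1) ≠ some i) (i : κ) :
    (Matrix (Fin (s+1)) (Fin (s+1)) R)ˣ where
  val := 1 + Xm R s idx i
  inv := 1 - Xm R s idx i
  val_inv := by
    have := Xm_sq R s idx h i
    noncomm_ring; simp [this]
  inv_val := by
    have := Xm_sq R s idx h i
    noncomm_ring; simp [this]

lemma Um_zpow (R : Type*) [Ring R] (s : ℕ) (idx : ℕ → Option κ)
    (h : ∀ j i, idx j = some i → idx (j+1) ≠ some i) (i : κ) (n : ℤ) :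
    ((Um R s idx h i ^ n : (Matrix (Fin (s+1)) (Fin (s+1)) R)ˣ) : Matrix (Fin (s+1)) (Fin (s+1)) R)
      = 1 + n • Xm R s idx i := by
  have hX := Xm_sq R s idx h i
  induction n with
  | zero => simp
  | succ n ih =>
    rw [zpow_add_one, Units.val_mul, ih]
    change (1 + (n:ℤ) • Xm R s idx i) * (1 + Xm R s idx i) = _
    rw [mul_add, add_mul, add_mul, smul_mul_assoc, smul_mul_assoc, hX, add_smul]
    simp; abel
  | pred n ih =>
    rw [zpow_sub_one, Units.val_mul, ih]
    change (1 + (-(n:ℤ)) • Xm R s idx i) * (1 - Xm R s idx i) = _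
    rw [mul_sub, add_mul, add_mul, smul_mul_assoc, smul_mul_assoc, hX, sub_smul]
    simp; abel

lemma prod_row (R : Type*) [CommRing R] (s : ℕ) (idx : ℕ → Option κ) (i : ℕ → κ) (n : ℕ → ℤ)
    (hi : ∀ j < s, idx j = some (i j)) (t : ℕ) (ht : t ≤ s) :
    (∀ b : Fin (s+1), t < b → (((List.range t).map
      (fun j => (1 + n j • Xm R s idx (i j)))).prod) 0 b = 0) ∧
    (((List.range t).map (fun j => (1 + n j • Xm R s idx (i j)))).prod) 0 ⟨t, by omega⟩
      = ((∏ j ∈ Finset.range t, n j : ℤ) : R) := by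
  induction t with
  | zero =>
    constructor
    · intro b hb
      simp only [List.range_zero, List.map_nil, List.prod_nil]
      rw [Matrix.one_apply_ne]
      rintro rfl; simp at hb
    · simp
  | succ t ih =>
    obtain ⟨h1, h2⟩ := ih (by omega)
    simp only [List.range_succ, List.map_append, List.prod_append, List.map_cons, List.map_nil,
      List.prod_cons, List.prod_nil, mul_one]
    set P := ((List.range t).map (fun j => (1 + n j • Xm R s idx (i j)))).prod with hP
    constructor
    · intro b hb
      rw [mul_add, mul_one, Matrix.add_apply, h1 b (by omega), zero_add, mul_smul_comm,
        Matrix.smul_apply, Matrix.mul_apply, Finset.sum_eq_zero, smul_zero]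
      intro c _
      by_cases hc : t < c
      · rw [h1 c hc, zero_mul]
      · simp only [Xm, Matrix.of_apply]
        rw [if_neg, mul_zero]
        rintro ⟨h, -⟩; omega
    · rw [mul_add, mul_one, Matrix.add_apply, h1 _ (by simp), zero_add, mul_smul_comm,
        Matrix.smul_apply, Matrix.mul_apply, Finset.sum_eq_single ⟨t, by omega⟩]
      · rw [h2, Finset.prod_range_succ]
        simp only [Xm, Matrix.of_apply]
        rw [if_pos (by exact ⟨trivial, hi t (by omega)⟩)]
        push_cast
        simp [mul_comm]
      · intro c _ hc
        simp only [Xm, Matrix.of_apply]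
        rw [if_neg, mul_zero]
        rintro ⟨h, -⟩
        apply hc
        ext; simp only; omega
      · simp

lemma unit_zpow (m : FreeGroup Unit) : ∃ n : ℤ, m = FreeGroup.of () ^ n :=
  ⟨FreeGroup.freeGroupUnitEquivInt m, (FreeGroup.freeGroupUnitEquivInt.left_inv m).symm⟩

theorem resid_one (x : FreeGroup κ) (hx : x ≠ 1) :
    ∃ (Q : Type) (_ : Group Q) (_ : Fintype Q) (n : ℕ), Fintype.card Q = 2 ^ n ∧
      ∃ π : FreeGroup κ →* Q, π x ≠ 1 := by
  let M : κ → Type := fun _ => FreeGroup Unit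
  let w : Monoid.CoprodI.Word M := Monoid.CoprodI.Word.equiv (freeGroupEquivCoprodI x)
  have hw : w.prod = freeGroupEquivCoprodI x := Monoid.CoprodI.Word.equiv.left_inv _
  let s := w.toList.length
  let idx : ℕ → Option κ := fun j => (w.toList[j]?).map Sigma.fst
  have hidx : ∀ j i, idx j = some i → idx (j+1) ≠ some i := by
    intro j i h1 h2
    simp only [idx, Option.map_eq_some_iff, List.getElem?_eq_some_iff] at h1 h2
    obtain ⟨a, ⟨ha, rfl⟩, rfl⟩ := h1
    obtain ⟨b, ⟨hb, rfl⟩, h⟩ := h2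
    exact (List.isChain_iff_getElem.1 w.chain_ne j hb) h.symm
  have hs : 0 < s := by
    rcases Nat.eq_zero_or_pos s with h | h
    · exfalso
      apply hx
      have : w.toList = [] := List.length_eq_zero_iff.1 h
      have h1 : w.prod = 1 := by simp [Monoid.CoprodI.Word.prod, this]
      rw [h1] at hw
      exact (MulEquiv.map_eq_one_iff freeGroupEquivCoprodI).1 hw.symm
    · exact h
  let i : ℕ → κ := fun j => if h : j < s then (w.toList[j]).1 else (w.toList[0]).1
  let e : FreeGroup Unit → ℤ := fun m => (unit_zpow m).choose
  have he : ∀ m, m = FreeGroup.of () ^ e m := fun m => (unit_zpow m).choose_spec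
  let n : ℕ → ℤ := fun j => if h : j < s then e (w.toList[j]).2 else 0
  have hi : ∀ j < s, idx j = some (i j) := by
    intro j hj
    simp only [idx, i, dif_pos hj]
    rw [List.getElem?_eq_getElem hj]; rfl
  set c : ℤ := ∏ j ∈ Finset.range s, n j with hc
  have hc0 : c ≠ 0 := by
    rw [hc, Finset.prod_ne_zero_iff]
    intro j hj
    have hj' : j < s := Finset.mem_range.1 hj
    simp only [n, dif_pos hj']
    intro h0
    have := he (w.toList[j]).2
    rw [h0, zpow_zero] at this
    exact w.ne_one _ (List.getElem_mem hj') this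
  let N := c.natAbs
  let R := ZMod (2 ^ N)
  let f : FreeGroup κ →* (Matrix (Fin (s+1)) (Fin (s+1)) R)ˣ := FreeGroup.lift (Um R s idx hidx)
  have hfx : ((f x : (Matrix (Fin (s+1)) (Fin (s+1)) R)ˣ) : Matrix (Fin (s+1)) (Fin (s+1)) R) =
      ((List.range s).map (fun j => (1 + n j • Xm R s idx (i j)))).prod := by
    have h1 : x = (Monoid.CoprodI.lift fun i => FreeGroup.lift fun _ => FreeGroup.of i) w.prod := by
      rw [hw]
      exact (freeGroupEquivCoprodI.left_inv x).symm
    conv_lhs => rw [h1]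
    rw [Monoid.CoprodI.Word.prod, map_list_prod, map_list_prod, ← Units.coeHom_apply, map_list_prod]
    congr 1
    rw [List.map_map, List.map_map, List.map_map]
    apply List.ext_getElem
    · simp [s]
    · intro j hj1 hj2
      have hj : j < s := by simpa [s] using hj1
      have hnj : n j = e (w.toList[j]).2 := dif_pos hj
      have hij : i j = (w.toList[j]).1 := dif_pos hj
      simp only [List.getElem_map, List.getElem_range, Function.comp]
      rw [hnj, hij]
      rw [Monoid.CoprodI.lift_of]
      conv_lhs => rw [he (w.toList[j]).2]
      rw [map_zpow, FreeGroup.lift_apply_of, map_zpow, FreeGroup.lift_apply_of, Units.coeHom_apply,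
        Um_zpow]
  have hrow := (prod_row R s idx i n hi s le_rfl).2
  have hf1 : f x ≠ 1 := by
    intro h
    rw [← hfx, h, Units.val_one, Matrix.one_apply_ne] at hrow
    · have h3 := hrow.symm
      rw [ZMod.intCast_zmod_eq_zero_iff_dvd] at h3
      have := Int.natAbs_dvd_natAbs.2 h3
      have := Nat.le_of_dvd (Int.natAbs_pos.2 hc0) this
      have h5 : N < 2 ^ N := Nat.lt_two_pow_self
      simp at this
      omega
    · intro h; have := congrArg Fin.val h
      simp at this; omega
  have : Fintype (ZMod (2 ^ N)) := ZMod.fintype _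
  have hfin : Finite (Matrix (Fin (s+1)) (Fin (s+1)) R)ˣ := by
    have : Finite (Matrix (Fin (s+1)) (Fin (s+1)) R) := by
      unfold Matrix; infer_instance
    infer_instance
  have hp : IsPGroup 2 f.range := by
    have huni : ∀ y, Uni ((f y : (Matrix (Fin (s+1)) (Fin (s+1)) R)ˣ) :
        Matrix (Fin (s+1)) (Fin (s+1)) R) := by
      have base : ∀ (m : ℤ) i, Uni (1 + m • Xm R s idx i) := by
        intro m i a b hab
        rw [Matrix.add_apply, Matrix.one_apply, Matrix.smul_apply]
        simp only [Xm, Matrix.of_apply]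
        rw [if_neg (c := (b : ℕ) = a + 1 ∧ idx a = some i)]
        · simp
        · rintro ⟨h, -⟩; rw [Fin.le_def] at hab; omega
      intro y
      induction y using FreeGroup.induction_on with
      | C1 =>
        intro a b hab
        rw [map_one, Units.val_one, Matrix.one_apply]
      | of i => 
        have := base 1 i
        rw [← Um_zpow R s idx hidx, zpow_one] at this
        simpa [f] using this
      | inv_of i _ => 
        have := base (-1) i
        rw [← Um_zpow R s idx hidx, zpow_neg_one] at this
        simpa [f] using this
      | mul a b ha hb => rw [map_mul, Units.val_mul]; exact ha.mul hb
    rintro ⟨_, y, rfl⟩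
    refine ⟨N + (s+1), ?_⟩
    ext1
    rw [Subgroup.coe_pow, Subgroup.coe_one]
    ext1
    rw [Units.val_pow_eq_pow_val, Units.val_one]
    have h2 : (2 : Matrix (Fin (s+1)) (Fin (s+1)) R) ^ N = 0 := by
      have : ((2 ^ N : ℕ) : R) = 0 := ZMod.natCast_self _
      have h3 : ((2 ^ N : ℕ) : Matrix (Fin (s+1)) (Fin (s+1)) R) = 0 := by
        rw [← Matrix.diagonal_natCast, this]; simp
      simpa using h3
    have := unip_pow _ (s+1) N (huni y).pow_sub h2
    simpa using this
  have hft : Fintype f.range := Fintype.ofFinite _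
  obtain ⟨k, hk⟩ := IsPGroup.iff_card.1 hp
  refine ⟨f.range, inferInstance, hft, k, by rw [← hk, Nat.card_eq_fintype_card], f.rangeRestrict, ?_⟩
  intro h
  exact hf1 (congrArg Subtype.val h)

theorem resid (S : Finset (FreeGroup κ)) (hS : ∀ x ∈ S, x ≠ 1) :
    ∃ (Q : Type) (_ : Group Q) (_ : Fintype Q) (n : ℕ), Fintype.card Q = 2 ^ n ∧
      ∃ π : FreeGroup κ →* Q, ∀ x ∈ S, π x ≠ 1 := by
  induction S using Finset.induction_on with
  | empty => exact ⟨Unit, inferInstance, inferInstance, 0, by simp, 1, by simp⟩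
  | insert a S ha ih =>
    obtain ⟨Q, _, _, n, hn, π, hπ⟩ := ih (fun x hx => hS x (Finset.mem_insert_of_mem hx))
    obtain ⟨Q', _, _, n', hn', π', hπ'⟩ := resid_one a (hS a (Finset.mem_insert_self _ _))
    refine ⟨Q × Q', inferInstance, inferInstance, n + n', by rw [Fintype.card_prod, hn, hn', pow_add],
      π.prod π', ?_⟩
    intro x hx h
    rw [MonoidHom.prod_apply, Prod.mk_eq_one] at h
    rcases Finset.mem_insert.1 hx with rfl | hx
    · exact hπ' h.2
    · exact hπ x hx h.1

theorem hopf {α : Type*} [Finite α] (f : FreeGroup α →* FreeGroup α) (hf : Function.Surjective f) :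
    Function.Injective f := by
  rw [injective_iff_map_eq_one]
  intro x hx
  by_contra hne
  obtain ⟨Q, _, _, n, hn, π, hπ⟩ := resid_one x hne
  have : Finite (FreeGroup α →* Q) := Finite.of_equiv _ FreeGroup.lift
  have inj : Function.Injective (fun ψ : FreeGroup α →* Q => ψ.comp f) := by
    intro a b h
    exact (MonoidHom.cancel_right hf).1 h
  obtain ⟨ψ, hψ⟩ := Finite.surjective_of_injective inj π
  apply hπ
  rw [← hψ]
  simp [hx]
end
end S16
end

section
namespace S16
noncomputable section
open Classical
open Filter Topology

section mat
variable {X : Type*} [Fintype X] [DecidableEq X]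

lemma scal_bound (t C : ℝ) (ht : 0 < t) (htC : t ≤ C) (S : ℕ) :
    (1 - C⁻¹ * t) ^ S * (∑ k ∈ Finset.range S, 1 / ((k : ℝ) + 1)) ≤ Real.log C - Real.log t := by
  have hC : 0 < C := ht.trans_le htC
  set a := 1 - C⁻¹ * t with ha
  have h0 : 0 ≤ a := by
    have : C⁻¹ * t ≤ 1 := by rw [inv_mul_le_iff₀ hC]; linarith
    linarith
  have h1 : a < 1 := by
    have : 0 < C⁻¹ * t := by positivity
    linarith
  have hs := Real.hasSum_pow_div_log_of_abs_lt_one (x := a) (by rw [abs_of_nonneg h0]; exact h1)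
  have e : -Real.log (1 - a) = Real.log C - Real.log t := by
    have : 1 - a = t / C := by rw [ha]; field_simp; ring
    rw [this, Real.log_div ht.ne' hC.ne']; ring
  rw [e] at hs
  refine le_trans ?_ (sum_le_hasSum (Finset.range S) (fun k _ => by positivity) hs)
  rw [Finset.mul_sum]
  refine Finset.sum_le_sum fun k hk => ?_
  rw [mul_one_div]
  gcongr ?_ / _
  exact pow_le_pow_of_le_one h0 h1.le (Finset.mem_range.1 hk)

lemma trace_bound (N : Matrix X X ℤ) (hdet : N.det ≠ 0) (c : ℝ) (hc : 1 ≤ c)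
    (hr : ∀ q, ∑ r, |(N q r : ℝ)| ≤ c) (hcol : ∀ r, ∑ q, |(N q r : ℝ)| ≤ c) (S : ℕ) :
    ((1 - (c ^ 2)⁻¹ • ((N.map (Int.cast : ℤ → ℝ)).transpose * N.map (Int.cast : ℤ → ℝ))) ^ S).trace *
      (∑ k ∈ Finset.range S, 1 / ((k : ℝ) + 1)) ≤ Fintype.card X * Real.log (c ^ 2) := by
  set NR : Matrix X X ℝ := N.map (Int.cast : ℤ → ℝ) with hNR
  set P := NR.transpose * NR with hP
  have hpsd : P.PosSemidef := by
    have := Matrix.posSemidef_conjTranspose_mul_self NR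
    rwa [Matrix.conjTranspose_eq_transpose_of_trivial] at this
  have hH : P.IsHermitian := hpsd.isHermitian
  have hdetP : 1 ≤ P.det := by
    have h1 : NR.det = (N.det : ℝ) := by
      rw [hNR]
      exact (Int.cast_det N).symm
    rw [hP, Matrix.det_mul, Matrix.det_transpose, h1]
    have h2 : 1 ≤ |N.det| := Int.one_le_abs hdet
    have h3 : (1 : ℝ) ≤ |(N.det : ℝ)| := by exact_mod_cast h2
    nlinarith [abs_mul_abs_self (N.det : ℝ)]
  have hdetprod : P.det = ∏ i, hH.eigenvalues i := by
    have := hH.det_eq_prod_eigenvalues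
    simpa using this
  have hpos : ∀ i, 0 < hH.eigenvalues i := by
    intro i
    refine lt_of_le_of_ne (hpsd.eigenvalues_nonneg i) fun h => ?_
    rw [hdetprod, Finset.prod_eq_zero (Finset.mem_univ i) h.symm] at hdetP
    linarith
  have hle : ∀ i, hH.eigenvalues i ≤ c ^ 2 := by
    intro i
    set v : X → ℝ := (hH.eigenvectorBasis i).ofLp with hv
    have hvne : v ≠ 0 := by
      intro h
      have h2 := hH.eigenvectorBasis.toBasis.ne_zero i
      apply h2
      simp only [OrthonormalBasis.coe_toBasis]
      ext x
      have := congrFun h x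
      simpa [hv] using this
    have hev : P.mulVec v = hH.eigenvalues i • v := hH.mulVec_eigenvectorBasis i
    obtain ⟨q0, hq0⟩ := Function.ne_iff.1 hvne
    have : Nonempty X := ⟨q0⟩
    obtain ⟨q, -, hq⟩ := Finset.exists_max_image Finset.univ (fun q => |v q|) ⟨q0, Finset.mem_univ _⟩
    have hqpos : 0 < |v q| := lt_of_lt_of_le (abs_pos.2 hq0) (hq q0 (Finset.mem_univ _))
    have h1 : (NR.transpose.mulVec (NR.mulVec v)) q = hH.eigenvalues i * v q := by
      rw [Matrix.mulVec_mulVec]; exact congrFun hev q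
    have b1 : ∀ r, |(NR.mulVec v) r| ≤ c * |v q| := by
      intro r
      simp only [Matrix.mulVec, dotProduct]
      calc |∑ x, NR r x * v x| ≤ ∑ x, |NR r x * v x| := Finset.abs_sum_le_sum_abs _ _
        _ ≤ ∑ x, |NR r x| * |v q| := by
          refine Finset.sum_le_sum fun x _ => ?_
          rw [abs_mul]
          exact mul_le_mul_of_nonneg_left (hq x (Finset.mem_univ _)) (abs_nonneg _)
        _ = (∑ x, |NR r x|) * |v q| := by rw [Finset.sum_mul]
        _ ≤ c * |v q| := by gcongr; exact hr r
    have b2 : |(NR.transpose.mulVec (NR.mulVec v)) q| ≤ c * (c * |v q|) := by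
      simp only [Matrix.mulVec, dotProduct, Matrix.transpose_apply]
      calc |∑ x, NR x q * _| ≤ ∑ x, |NR x q * _| := Finset.abs_sum_le_sum_abs _ _
        _ ≤ ∑ x, |NR x q| * (c * |v q|) := by
          refine Finset.sum_le_sum fun x _ => ?_
          rw [abs_mul]
          exact mul_le_mul_of_nonneg_left (b1 x) (abs_nonneg _)
        _ = (∑ x, |NR x q|) * (c * |v q|) := by rw [Finset.sum_mul]
        _ ≤ c * (c * |v q|) := by gcongr; exact hcol q
    rw [h1, abs_mul, abs_of_pos (hpos i)] at b2
    have : hH.eigenvalues i * |v q| ≤ c ^ 2 * |v q| := by rw [pow_two, mul_assoc]; exact b2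
    exact le_of_mul_le_mul_right this hqpos
  have htr : ((1 - (c ^ 2)⁻¹ • P) ^ S).trace = ∑ i, (1 - (c ^ 2)⁻¹ * hH.eigenvalues i) ^ S := by
    have sp := hH.spectral_theorem
    have : (1 - (c ^ 2)⁻¹ • P) ^ S = Unitary.conjStarAlgAut ℝ (Matrix X X ℝ) hH.eigenvectorUnitary
        (Matrix.diagonal (fun i => (1 - (c ^ 2)⁻¹ * hH.eigenvalues i) ^ S)) := by
      have hd : (Matrix.diagonal (fun i => (1 - (c ^ 2)⁻¹ * hH.eigenvalues i) ^ S) : Matrix X X ℝ) =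
          (1 - (c ^ 2)⁻¹ • Matrix.diagonal (hH.eigenvalues)) ^ S := by
        rw [← Matrix.diagonal_one, ← Matrix.diagonal_smul, Matrix.diagonal_sub, Matrix.diagonal_pow]
        rfl
      rw [hd, map_pow, map_sub, map_one, map_smul]
      congr 3
    rw [this, Unitary.conjStarAlgAut_apply, Matrix.trace_mul_comm, ← mul_assoc]
    simp [Matrix.trace_diagonal]
  rw [htr, Finset.sum_mul]
  calc _ ≤ ∑ i, (Real.log (c ^ 2) - Real.log (hH.eigenvalues i)) :=
        Finset.sum_le_sum fun i _ => scal_bound _ _ (hpos i) (hle i) S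
    _ = Fintype.card X * Real.log (c ^ 2) - Real.log P.det := by
        rw [Finset.sum_sub_distrib, hdetprod, Real.log_prod (fun i _ => (hpos i).ne')]
        simp
    _ ≤ _ := by have := Real.log_nonneg hdetP; linarith
end mat

end
end S16
end

section
namespace S16
noncomputable section
open Classical
open Filter Topology

section luck
variable {ι K : Type*} [Fintype ι] [Group K]

def rowM (M : ι → ι → (K →₀ ℤ)) (q : ι × K) : (ι × K) →₀ ℝ :=
  ∑ l, (M q.1 l).sum (fun y c => Finsupp.single (l, q.2 * y) (c : ℝ))
def colM (M : ι → ι → (K →₀ ℤ)) (q : ι × K) : (ι × K) →₀ ℝ :=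
  ∑ i, (M i q.1).sum (fun y c => Finsupp.single (i, q.2 * y⁻¹) (c : ℝ))

lemma rowM_apply (M : ι → ι → (K →₀ ℤ)) (q r : ι × K) :
    rowM M q r = (M q.1 r.1 (q.2⁻¹ * r.2) : ℝ) := by
  simp only [rowM, Finsupp.finsetSum_apply, Finsupp.sum]
  rw [Finset.sum_eq_single r.1]
  · rw [Finset.sum_eq_single (q.2⁻¹ * r.2)]
    · simp
    · intro b _ hb
      rw [Finsupp.single_apply, if_neg]
      intro h; apply hb; rw [← h]; simp
    · intro h
      simp [Finsupp.notMem_support_iff.1 h]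
  · intro l _ hl
    refine Finset.sum_eq_zero fun y _ => ?_
    rw [Finsupp.single_apply, if_neg]
    intro h; apply hl; rw [← h]
  · simp

lemma colM_apply (M : ι → ι → (K →₀ ℤ)) (q r : ι × K) :
    colM M r q = (M q.1 r.1 (q.2⁻¹ * r.2) : ℝ) := by
  simp only [colM, Finsupp.finsetSum_apply, Finsupp.sum]
  rw [Finset.sum_eq_single q.1]
  · rw [Finset.sum_eq_single (q.2⁻¹ * r.2)]
    · simp
    · intro b _ hb
      rw [Finsupp.single_apply, if_neg]
      intro h; apply hb; rw [← h]; simp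
    · intro h
      simp [Finsupp.notMem_support_iff.1 h]
  · intro l _ hl
    refine Finset.sum_eq_zero fun y _ => ?_
    rw [Finsupp.single_apply, if_neg]
    intro h; apply hl; rw [← h]
  · simp

abbrev Tm (M : ι → ι → (K →₀ ℤ)) : ((ι × K) →₀ ℝ) →ₗ[ℝ] ((ι × K) →₀ ℝ) :=
  Finsupp.linearCombination ℝ (colM M)
abbrev Tst (M : ι → ι → (K →₀ ℤ)) : ((ι × K) →₀ ℝ) →ₗ[ℝ] ((ι × K) →₀ ℝ) :=
  Finsupp.linearCombination ℝ (rowM M)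

def ip {X : Type*} (f g : X →₀ ℝ) : ℝ := Finsupp.linearCombination ℝ (⇑g) f

lemma ip_comm {X : Type*} (f g : X →₀ ℝ) : ip f g = ip g f := by
  simp only [ip, Finsupp.linearCombination_apply]
  rw [Finsupp.sum_of_support_subset f (s := f.support ∪ g.support) Finset.subset_union_left _ (by simp),
    Finsupp.sum_of_support_subset g (s := f.support ∪ g.support) Finset.subset_union_right _ (by simp)]
  exact Finset.sum_congr rfl fun x _ => by simp [mul_comm]

lemma ip_add_left {X : Type*} (f f' g : X →₀ ℝ) : ip (f + f') g = ip f g + ip f' g := by simp [ip]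
lemma ip_sub_left {X : Type*} (f f' g : X →₀ ℝ) : ip (f - f') g = ip f g - ip f' g := by simp [ip]
lemma ip_smul_left {X : Type*} (c : ℝ) (f g : X →₀ ℝ) : ip (c • f) g = c * ip f g := by simp [ip]
lemma ip_add_right {X : Type*} (f f' g : X →₀ ℝ) : ip g (f + f') = ip g f + ip g f' := by
  rw [ip_comm, ip_add_left, ip_comm f, ip_comm f']
lemma ip_sub_right {X : Type*} (f f' g : X →₀ ℝ) : ip g (f - f') = ip g f - ip g f' := by
  rw [ip_comm, ip_sub_left, ip_comm f, ip_comm f']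
lemma ip_smul_right {X : Type*} (c : ℝ) (f g : X →₀ ℝ) : ip g (c • f) = c * ip g f := by
  rw [ip_comm, ip_smul_left, ip_comm f]
lemma ip_single {X : Type*} (x : X) (g : X →₀ ℝ) : ip (Finsupp.single x 1) g = g x := by simp [ip]
lemma ip_self {X : Type*} (f : X →₀ ℝ) : ip f f = ∑ x ∈ f.support, f x ^ 2 := by
  simp [ip, Finsupp.linearCombination_apply, Finsupp.sum, pow_two]

lemma ip_Tm (M : ι → ι → (K →₀ ℤ)) (f g : (ι × K) →₀ ℝ) : ip (Tm M f) g = ip f (Tst M g) := by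
  induction f using Finsupp.induction_linear with
  | zero => simp [ip]
  | add a b ha hb => rw [map_add, ip_add_left, ip_add_left, ha, hb]
  | single r c =>
    induction g using Finsupp.induction_linear with
    | zero => rw [map_zero, ip_comm, ip_comm _ 0]; simp [ip]
    | add a b ha hb => rw [map_add, ip_add_right, ip_add_right, ha, hb]
    | single q d =>
      have e1 : (Finsupp.single r c : (ι × K) →₀ ℝ) = c • Finsupp.single r 1 := by simp
      have e2 : (Finsupp.single q d : (ι × K) →₀ ℝ) = d • Finsupp.single q 1 := by simp
      rw [e1, e2, map_smul, map_smul, ip_smul_left, ip_smul_left, ip_smul_right, ip_smul_right,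
        ip_single, ip_comm, ip_single]
      simp [rowM_apply, colM_apply]

def Ah (M : ι → ι → (K →₀ ℤ)) (c : ℝ) : ((ι × K) →₀ ℝ) →ₗ[ℝ] ((ι × K) →₀ ℝ) :=
  LinearMap.id - (c ^ 2)⁻¹ • (Tst M ∘ₗ Tm M)

lemma Ah_apply (M : ι → ι → (K →₀ ℤ)) (c : ℝ) (f) : Ah M c f = f - (c ^ 2)⁻¹ • Tst M (Tm M f) := rfl

lemma ip_Ah (M : ι → ι → (K →₀ ℤ)) (c : ℝ) (f g) : ip (Ah M c f) g = ip f (Ah M c g) := by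
  rw [Ah_apply, Ah_apply, ip_sub_left, ip_sub_right, ip_smul_left, ip_smul_right, ← ip_Tm,
    ip_comm (Tst M _) g, ← ip_Tm, ip_comm (Tm M g)]

lemma ip_Ah_pow (M : ι → ι → (K →₀ ℤ)) (c : ℝ) (n : ℕ) : ∀ f g,
    ip ((Ah M c ^ n) f) g = ip f ((Ah M c ^ n) g) := by
  induction n with
  | zero => intro f g; rfl
  | succ n ih =>
    intro f g
    rw [pow_succ, Module.End.mul_apply, ih, ip_Ah, ← Module.End.mul_apply, ← pow_succ', pow_succ]

lemma w_Ah (M : ι → ι → (K →₀ ℤ)) (c : ℝ) (w : ι × K → ℝ)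
    (h0 : ∀ q, Finsupp.linearCombination ℝ w (rowM M q) = 0) (n : ℕ) (f) :
    Finsupp.linearCombination ℝ w ((Ah M c ^ n) f) = Finsupp.linearCombination ℝ w f := by
  have hT : ∀ f, Finsupp.linearCombination ℝ w (Tst M f) = 0 := by
    intro f
    induction f using Finsupp.induction_linear with
    | zero => simp
    | add a b ha hb => rw [map_add, map_add, ha, hb, add_zero]
    | single r c => simp [h0]
  induction n with
  | zero => rfl
  | succ n ih =>
    rw [pow_succ', Module.End.mul_apply, Ah_apply, map_sub, map_smul, hT, smul_zero, sub_zero, ih]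

lemma w_bound (M : ι → ι → (K →₀ ℤ)) (c : ℝ) (w : ι × K → ℝ) (hw : Summable fun x => w x ^ 2)
    (h0 : ∀ q, Finsupp.linearCombination ℝ w (rowM M q) = 0) (n : ℕ) (x : ι × K) :
    w x ^ 2 ≤ ((Ah M c ^ (2 * n)) (Finsupp.single x 1)) x * ∑' y, w y ^ 2 := by
  set u := (Ah M c ^ n) (Finsupp.single x 1) with hu
  have h1 : w x = Finsupp.linearCombination ℝ w u := by
    rw [hu, w_Ah M c w h0]; simp
  have h2 : ((Ah M c ^ (2 * n)) (Finsupp.single x 1)) x = ∑ y ∈ u.support, u y ^ 2 := by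
    rw [← ip_self, hu, ip_Ah_pow, ip_single, two_mul, pow_add]; rfl
  rw [h1, h2, Finsupp.linearCombination_apply, Finsupp.sum]
  refine (Finset.sum_mul_sq_le_sq_mul_sq _ _ _).trans ?_
  gcongr
  exact hw.sum_le_tsum _ (fun _ _ => sq_nonneg _)

variable {Q : Type*} [Group Q] [Fintype Q]

def Nq (M : ι → ι → (K →₀ ℤ)) (π : K →* Q) : Matrix (ι × Q) (ι × Q) ℤ :=
  fun q r => (M q.1 r.1).sum (fun y c => if q.2 * π y = r.2 then c else 0)

def fib (ι) (π : K →* Q) : ((ι × K) →₀ ℝ) →ₗ[ℝ] (ι × Q → ℝ) :=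
  Finsupp.linearCombination ℝ (fun p => Pi.single (p.1, π p.2) 1)

lemma fib_single (π : K →* Q) (p : ι × K) (c : ℝ) :
    fib ι π (Finsupp.single p c) = Pi.single (p.1, π p.2) c := by
  simp [fib, ← Pi.single_smul]

lemma fib_Tm (M : ι → ι → (K →₀ ℤ)) (π : K →* Q) (f) :
    fib ι π (Tm M f) = ((Nq M π).map (Int.cast : ℤ → ℝ)).mulVec (fib ι π f) := by
  induction f using Finsupp.induction_linear with
  | zero => simp
  | add a b ha hb => rw [map_add, map_add, ha, hb, map_add, Matrix.mulVec_add]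
  | single r c =>
    ext q
    simp only [Finsupp.linearCombination_single, map_smul, fib_single, colM, Finsupp.sum, map_sum,
      Pi.smul_apply, Finset.sum_apply, smul_eq_mul, Matrix.mulVec_single, Matrix.col_apply,
      MulOpposite.smul_eq_mul_unop, MulOpposite.unop_op, Matrix.map_apply, Nq]
    rw [Finset.sum_eq_single q.1]
    · push_cast
      rw [mul_comm]
      congr 1
      refine Finset.sum_congr rfl fun y _ => ?_
      rw [Pi.single_apply]
      by_cases h : q.2 * π y = π r.2
      · rw [if_pos h, if_pos]; ext <;> simp [← h]
      · rw [if_neg h, if_neg]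
        intro h'; apply h; rw [h']; simp
    · intro i _ hi
      refine Finset.sum_eq_zero fun y _ => ?_
      rw [Pi.single_apply, if_neg]
      intro h; exact hi (by rw [h])
    · simp

lemma fib_Tst (M : ι → ι → (K →₀ ℤ)) (π : K →* Q) (f) :
    fib ι π (Tst M f) = ((Nq M π).map (Int.cast : ℤ → ℝ)).transpose.mulVec (fib ι π f) := by
  induction f using Finsupp.induction_linear with
  | zero => simp
  | add a b ha hb => rw [map_add, map_add, ha, hb, map_add, Matrix.mulVec_add]
  | single r c =>
    ext q
    simp only [Finsupp.linearCombination_single, map_smul, fib_single, rowM, Finsupp.sum, map_sum,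
      Pi.smul_apply, Finset.sum_apply, smul_eq_mul, Matrix.mulVec_single, Matrix.col_apply,
      MulOpposite.smul_eq_mul_unop, MulOpposite.unop_op, Matrix.map_apply, Nq, Matrix.transpose_apply]
    rw [Finset.sum_eq_single q.1]
    · push_cast
      rw [mul_comm]
      congr 1
      refine Finset.sum_congr rfl fun y _ => ?_
      rw [Pi.single_apply]
      by_cases h : π r.2 * π y = q.2
      · rw [if_pos h, if_pos]; ext <;> simp [← h]
      · rw [if_neg h, if_neg]
        intro h'; apply h; rw [h']; simp
    · intro i _ hi
      refine Finset.sum_eq_zero fun y _ => ?_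
      rw [Pi.single_apply, if_neg]
      intro h; exact hi (by rw [h])
    · simp

def Bq (M : ι → ι → (K →₀ ℤ)) (π : K →* Q) (c : ℝ) : Matrix (ι × Q) (ι × Q) ℝ :=
  1 - (c ^ 2)⁻¹ • (((Nq M π).map (Int.cast : ℤ → ℝ)).transpose * (Nq M π).map (Int.cast : ℤ → ℝ))

lemma fib_Ah_pow (M : ι → ι → (K →₀ ℤ)) (π : K →* Q) (c : ℝ) (n : ℕ) (f) :
    fib ι π ((Ah M c ^ n) f) = (Bq M π c ^ n).mulVec (fib ι π f) := by
  induction n with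
  | zero => simp
  | succ n ih =>
    rw [pow_succ', Module.End.mul_apply, Ah_apply, map_sub, map_smul, fib_Tst, fib_Tm, ih, pow_succ' (Bq M π c),
      ← Matrix.mulVec_mulVec]
    conv_rhs => rw [Bq, Matrix.sub_mulVec, Matrix.one_mulVec, Matrix.smul_mulVec, ← Matrix.mulVec_mulVec]
    rfl

lemma fib_apply_eq (π : K →* Q) (f : (ι × K) →₀ ℝ) (i : ι)
    (hf : ∀ z, (i, z) ∈ f.support → z ≠ 1 → π z ≠ 1) : fib ι π f (i, 1) = f (i, 1) := by
  simp only [fib, Finsupp.linearCombination_apply, Finsupp.sum, Finset.sum_apply, Pi.smul_apply, smul_eq_mul]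
  rw [Finset.sum_eq_single (i, 1)]
  · simp
  · rintro ⟨j, z⟩ hz hne
    rw [Pi.single_apply, if_neg, mul_zero]
    intro h
    simp only [Prod.mk.injEq] at h
    obtain ⟨rfl, h2⟩ := h
    exact hf z hz (fun h => hne (by rw [h])) h2.symm
  · intro h; simp [Finsupp.notMem_support_iff.1 h]

end luck
end
end S16
end

section
namespace S16
noncomputable section
open Classical
open Filter Topology

section luck
variable {ι K : Type*} [Fintype ι] [Group K]
variable {Q : Type*} [Group Q] [Fintype Q]

lemma Nq_inv (M : ι → ι → (K →₀ ℤ)) (π : K →* Q) (t : Q) (q r : ι × Q) :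
    Nq M π (q.1, t * q.2) (r.1, t * r.2) = Nq M π q r := by
  simp [Nq, mul_assoc]

def tq (ι) (t : Q) : ι × Q ≃ ι × Q := (Equiv.refl ι).prodCongr (Equiv.mulLeft t)

lemma Bq_inv (M : ι → ι → (K →₀ ℤ)) (π : K →* Q) (c : ℝ) (t : Q) :
    (Bq M π c).submatrix (tq ι t) (tq ι t) = Bq M π c := by
  have h : ((Nq M π).map (Int.cast : ℤ → ℝ)).submatrix (tq ι t) (tq ι t) = (Nq M π).map (Int.cast : ℤ → ℝ) := by
    ext q r
    simp only [Matrix.submatrix_apply, Matrix.map_apply]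
    congr 1
    exact Nq_inv M π t q r
  simp only [Bq, Matrix.submatrix_sub, Matrix.submatrix_smul, Pi.sub_apply, Pi.smul_apply]
  rw [Matrix.submatrix_one_equiv, ← Matrix.submatrix_mul_equiv _ _ _ (tq ι t) _, ← Matrix.transpose_submatrix, h]

lemma Bq_pow_inv (M : ι → ι → (K →₀ ℤ)) (π : K →* Q) (c : ℝ) (t : Q) (n : ℕ) :
    (Bq M π c ^ n).submatrix (tq ι t) (tq ι t) = Bq M π c ^ n := by
  induction n with
  | zero => simp [Matrix.submatrix_one_equiv]
  | succ n ih =>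
    rw [pow_succ, ← Matrix.submatrix_mul_equiv _ _ _ (tq ι t) _, ih, Bq_inv]

lemma Bq_trace (M : ι → ι → (K →₀ ℤ)) (π : K →* Q) (c : ℝ) (n : ℕ) :
    (Bq M π c ^ n).trace = Fintype.card Q * ∑ i, (Bq M π c ^ n) (i, 1) (i, 1) := by
  rw [Matrix.trace, Fintype.sum_prod_type, Finset.mul_sum]
  refine Finset.sum_congr rfl fun i _ => ?_
  rw [← nsmul_eq_mul, ← Finset.card_univ, ← Finset.sum_const]
  refine Finset.sum_congr rfl fun t _ => ?_
  have := congrFun (congrFun (Bq_pow_inv M π c t n) (i, 1)) (i, 1)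
  rw [← this]
  simp [tq]

lemma Nq_det (M : ι → ι → (K →₀ ℤ))
    (haug : ∀ i l, (M i l).sum (fun _ c => c) = if i = l then 1 else 0)
    (π : K →* Q) (n : ℕ) (hQ : Fintype.card Q = 2 ^ n) : (Nq M π).det ≠ 0 := by
  intro h
  set N := (Nq M π).map (Int.castRingHom (ZMod 2)) with hN
  have hd : N.det = 0 := by
    have := (Int.castRingHom (ZMod 2)).map_det (Nq M π)
    rw [h, map_zero] at this
    exact this.symm
  obtain ⟨v, hv, hNv⟩ := Matrix.exists_mulVec_eq_zero_iff.2 hd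
  let W : Submodule (ZMod 2) (ι × Q → ZMod 2) := LinearMap.ker N.mulVecLin
  have hinv : ∀ t : Q, ∀ u : ι × Q → ZMod 2, N.mulVec (u ∘ tq ι t) = N.mulVec u ∘ tq ι t := by
    intro t u
    have : N.submatrix (tq ι t) (tq ι t) = N := by
      ext q r
      simp only [hN, Matrix.submatrix_apply, Matrix.map_apply]
      congr 1
      exact Nq_inv M π t q r
    conv_lhs => rw [← this]
    rw [Matrix.submatrix_mulVec_equiv]
    simp [Function.comp_assoc]
  letI act : MulAction Q W :=
    { smul := fun t u => ⟨(u : ι × Q → ZMod 2) ∘ tq ι t⁻¹, by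
        have hu : N.mulVec u = 0 := u.2
        change N.mulVec _ = 0
        rw [hinv, hu]; rfl⟩
      one_smul := fun u => by
        apply Subtype.ext; funext q
        change (u : ι × Q → ZMod 2) (tq ι (1 : Q)⁻¹ q) = _
        simp [tq]
      mul_smul := fun s t u => by
        apply Subtype.ext; funext q
        change (u : ι × Q → ZMod 2) (tq ι (s * t)⁻¹ q) = (u : ι × Q → ZMod 2) (tq ι t⁻¹ (tq ι s⁻¹ q))
        obtain ⟨i, x⟩ := q
        simp [tq, mul_assoc] }
  have hsm : ∀ (t : Q) (u : W) q, ((t • u : W) : ι × Q → ZMod 2) q = (u : ι × Q → ZMod 2) (tq ι t⁻¹ q) :=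
    fun _ _ _ => rfl
  have hp : IsPGroup 2 Q := IsPGroup.of_card (n := n) (by rw [Nat.card_eq_fintype_card, hQ])
  have hdvd : 2 ∣ Nat.card W := by
    let v' : W := ⟨v, hNv⟩
    have : addOrderOf v' = 2 := by
      apply addOrderOf_eq_prime
      · apply Subtype.ext; funext q
        change 2 • v q = 0
        rw [two_nsmul]
        exact CharTwo.add_self_eq_zero _
      · intro h; apply hv; exact congrArg Subtype.val h
    exact (dvd_of_eq this.symm).trans (addOrderOf_dvd_natCard v')
  obtain ⟨u, hu, hne⟩ := hp.exists_fixed_point_of_prime_dvd_card_of_fixed_point W hdvd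
    (a := (0 : W)) (fun t => by apply Subtype.ext; funext q; rw [hsm]; rfl)
  apply hne
  apply Subtype.ext; funext q
  obtain ⟨i, x⟩ := q
  have hc : ∀ l z, (u : ι × Q → ZMod 2) (l, z) = (u : ι × Q → ZMod 2) (l, 1) := by
    intro l z
    have := congrFun (congrArg Subtype.val (hu z)) (l, z)
    rw [hsm] at this
    rw [← this]; simp [tq]
  have h1 : N.mulVec u (i, x) = 0 := by
    have : N.mulVec u = 0 := u.2
    rw [this]; rfl
  simp only [Matrix.mulVec, dotProduct, Fintype.sum_prod_type] at h1
  have h2 : ∀ l, ∑ z, N (i, x) (l, z) * (u : ι × Q → ZMod 2) (l, z) =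
      (if i = l then 1 else 0) * (u : ι × Q → ZMod 2) (l, 1) := by
    intro l
    rw [Finset.sum_congr rfl (fun z _ => by rw [hc l z]), ← Finset.sum_mul]
    congr 1
    have : ∑ z, Nq M π (i, x) (l, z) = if i = l then 1 else 0 := by
      rw [← haug i l]
      simp only [Nq, Finsupp.sum]
      rw [Finset.sum_comm]
      simp
    simp only [hN, Matrix.map_apply]
    rw [← map_sum, this]
    split_ifs <;> simp
  rw [Finset.sum_congr rfl (fun l _ => h2 l)] at h1
  simp only [ite_mul, one_mul, zero_mul, Finset.sum_ite_eq, Finset.mem_univ, if_true] at h1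
  rw [hc i x, h1]; rfl

def cM (M : ι → ι → (K →₀ ℤ)) : ℝ := 1 + ∑ i, ∑ l, (M i l).sum (fun _ c => |(c : ℝ)|)

lemma Nq_abs (M : ι → ι → (K →₀ ℤ)) (π : K →* Q) (q r) :
    |(Nq M π q r : ℝ)| ≤ (M q.1 r.1).sum (fun y c => if q.2 * π y = r.2 then |(c : ℝ)| else 0) := by
  simp only [Nq, Finsupp.sum]
  push_cast
  refine (Finset.abs_sum_le_sum_abs _ _).trans (le_of_eq ?_)
  refine Finset.sum_congr rfl fun y _ => ?_
  split_ifs <;> simp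

lemma Nq_row (M : ι → ι → (K →₀ ℤ)) (π : K →* Q) (q) : ∑ r, |(Nq M π q r : ℝ)| ≤ cM M := by
  refine (Finset.sum_le_sum fun r _ => Nq_abs M π q r).trans ?_
  rw [Fintype.sum_prod_type, cM]
  have : ∀ l, ∑ z : Q, (M q.1 l).sum (fun y c => if q.2 * π y = z then |(c : ℝ)| else 0) =
      (M q.1 l).sum (fun _ c => |(c : ℝ)|) := by
    intro l
    simp only [Finsupp.sum]
    rw [Finset.sum_comm]; simp
  rw [Finset.sum_congr rfl (fun l _ => this l)]
  have h2 : ∑ l, (M q.1 l).sum (fun _ c => |(c : ℝ)|) ≤ ∑ i, ∑ l, (M i l).sum (fun _ c => |(c : ℝ)|) :=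
    Finset.single_le_sum (f := fun i => ∑ l, (M i l).sum (fun _ c => |(c : ℝ)|))
      (fun i _ => Finset.sum_nonneg fun l _ => Finset.sum_nonneg fun y _ => abs_nonneg _) (Finset.mem_univ _)
  linarith

lemma Nq_col (M : ι → ι → (K →₀ ℤ)) (π : K →* Q) (r) : ∑ q, |(Nq M π q r : ℝ)| ≤ cM M := by
  refine (Finset.sum_le_sum fun q _ => Nq_abs M π q r).trans ?_
  rw [Fintype.sum_prod_type, cM]
  have : ∀ l, ∑ z : Q, (M l r.1).sum (fun y c => if z * π y = r.2 then |(c : ℝ)| else 0) =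
      (M l r.1).sum (fun _ c => |(c : ℝ)|) := by
    intro l
    simp only [Finsupp.sum]
    rw [Finset.sum_comm]; simp [← eq_mul_inv_iff_mul_eq]
  rw [Finset.sum_congr rfl (fun l _ => this l), Finset.sum_comm]
  have h2 : ∑ l, (M l r.1).sum (fun _ c => |(c : ℝ)|) ≤ ∑ i, ∑ l, (M l i).sum (fun _ c => |(c : ℝ)|) :=
    Finset.single_le_sum (f := fun i => ∑ l, (M l i).sum (fun _ c => |(c : ℝ)|))
      (fun i _ => Finset.sum_nonneg fun l _ => Finset.sum_nonneg fun y _ => abs_nonneg _) (Finset.mem_univ _)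
  linarith

lemma luck_one {κ : Type*} (M : ι → ι → (FreeGroup κ →₀ ℤ))
    (haug : ∀ i l, (M i l).sum (fun _ c => c) = if i = l then 1 else 0)
    (w : ι × FreeGroup κ → ℝ) (hw : Summable fun x => w x ^ 2)
    (h0 : ∀ q, Finsupp.linearCombination ℝ w (rowM M q) = 0) (i : ι) : w (i, 1) = 0 := by
  set c := cM M with hc
  have hc1 : 1 ≤ c := by
    rw [hc, cM]
    have : 0 ≤ ∑ i, ∑ l, (M i l).sum (fun _ c => |(c : ℝ)|) :=
      Finset.sum_nonneg fun l _ => Finset.sum_nonneg fun y _ => Finset.sum_nonneg fun y _ => abs_nonneg _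
    linarith
  set W := ∑' y, w y ^ 2 with hW
  have hW0 : 0 ≤ W := tsum_nonneg fun _ => sq_nonneg _
  have key : ∀ n : ℕ, (∑ i, w (i, 1) ^ 2) * (∑ k ∈ Finset.range (2 * n), 1 / ((k : ℝ) + 1)) ≤
      W * (Fintype.card ι * Real.log (c ^ 2)) := by
    intro n
    obtain ⟨Q, _, _, m, hQ, π, hπ⟩ := resid (κ := κ)
      ((Finset.univ.biUnion fun i => ((Ah M c ^ (2 * n)) (Finsupp.single (i, 1) 1)).support.image Prod.snd).filter (· ≠ 1))
      (by intro x hx; exact (Finset.mem_filter.1 hx).2)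
    have e1 : ∀ i, ((Ah M c ^ (2 * n)) (Finsupp.single (i, 1) 1)) (i, 1) = (Bq M π c ^ (2 * n)) (i, 1) (i, 1) := by
      intro i
      rw [← fib_apply_eq π _ i, fib_Ah_pow, fib_single]
      · simp
      · intro z hz hz1
        refine hπ z (Finset.mem_filter.2 ⟨Finset.mem_biUnion.2 ⟨i, Finset.mem_univ _, ?_⟩, hz1⟩)
        exact Finset.mem_image.2 ⟨(i, z), hz, rfl⟩
    have tb := trace_bound (Nq M π) (Nq_det M haug π m hQ) c hc1 (Nq_row M π) (Nq_col M π) (2 * n)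
    change (Bq M π c ^ (2 * n)).trace * _ ≤ _ at tb
    rw [Bq_trace, Fintype.card_prod, mul_assoc] at tb
    have hQ0 : (0 : ℝ) < Fintype.card Q := by exact_mod_cast Fintype.card_pos
    have tb2 : (∑ i, (Bq M π c ^ (2 * n)) (i, 1) (i, 1)) * (∑ k ∈ Finset.range (2 * n), 1 / ((k : ℝ) + 1))
        ≤ Fintype.card ι * Real.log (c ^ 2) := by
      refine le_of_mul_le_mul_left ?_ hQ0
      refine tb.trans (le_of_eq ?_)
      push_cast; ring
    have hs : ∑ i, w (i, 1) ^ 2 ≤ W * ∑ i, (Bq M π c ^ (2 * n)) (i, 1) (i, 1) := by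
      rw [Finset.mul_sum]
      refine Finset.sum_le_sum fun i _ => ?_
      rw [← e1, mul_comm]
      exact w_bound M c w hw h0 n (i, 1)
    calc _ ≤ (W * ∑ i, (Bq M π c ^ (2 * n)) (i, 1) (i, 1)) * (∑ k ∈ Finset.range (2 * n), 1 / ((k : ℝ) + 1)) := by
          gcongr
      _ = W * ((∑ i, (Bq M π c ^ (2 * n)) (i, 1) (i, 1)) * (∑ k ∈ Finset.range (2 * n), 1 / ((k : ℝ) + 1))) := by ring
      _ ≤ _ := by gcongr
  by_contra hne
  have hpos : 0 < ∑ i, w (i, 1) ^ 2 := by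
    refine lt_of_lt_of_le (by positivity : 0 < w (i, 1) ^ 2) ?_
    exact Finset.single_le_sum (f := fun i => w (i, 1) ^ 2) (fun i _ => sq_nonneg _) (Finset.mem_univ i)
  have ht := (Real.tendsto_sum_range_one_div_nat_succ_atTop.comp
    (tendsto_id.const_mul_atTop' (by norm_num : 0 < 2))).const_mul_atTop hpos
  obtain ⟨n, hn⟩ := (ht.eventually_gt_atTop (W * (Fintype.card ι * Real.log (c ^ 2)))).exists
  exact absurd (key n) (not_le.2 hn)

theorem luck {κ : Type*} (M : ι → ι → (FreeGroup κ →₀ ℤ))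
    (haug : ∀ i l, (M i l).sum (fun _ c => c) = if i = l then 1 else 0)
    (w : ι × FreeGroup κ → ℝ) (hw : Summable fun x => w x ^ 2)
    (h0 : ∀ i z, ∑ l, (M i l).sum (fun y c => (c : ℝ) * w (l, z * y)) = 0) : w = 0 := by
  funext ⟨i, z⟩
  have := luck_one M haug (fun p => w (p.1, z * p.2)) ?_ ?_ i
  · simpa using this
  · have hi : Function.Injective (fun p : ι × FreeGroup κ => (p.1, z * p.2)) := by
      rintro ⟨a, b⟩ ⟨c, d⟩ h
      simpa using h
    exact hw.comp_injective hi
  · intro q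
    rw [rowM, map_sum, ← h0 q.1 (z * q.2)]
    refine Finset.sum_congr rfl fun l _ => ?_
    simp only [Finsupp.sum, map_sum, Finsupp.linearCombination_single, smul_eq_mul, mul_assoc]

end luck
end
end S16
end

section
namespace S16
noncomputable section
open Classical

section fox
variable {α : Type*}

def shiftA (x : FreeGroup α) : ((α × FreeGroup α) →₀ ℤ) ≃+ ((α × FreeGroup α) →₀ ℤ) :=
  Finsupp.domCongr ((Equiv.refl α).prodCongr (Equiv.mulLeft x))

def shiftHom (α : Type*) : FreeGroup α →* MulAut (Multiplicative ((α × FreeGroup α) →₀ ℤ)) where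
  toFun x := AddEquiv.toMultiplicative (shiftA x)
  map_one' := by
    ext u ⟨l, y⟩
    change shiftA 1 (Multiplicative.toAdd u) (l, y) = _
    simp [shiftA, Finsupp.domCongr]
    rfl
  map_mul' x y := by
    ext u ⟨l, z⟩
    change shiftA (x * y) (Multiplicative.toAdd u) (l, z) = shiftA x (shiftA y (Multiplicative.toAdd u)) (l, z)
    simp [shiftA, Finsupp.domCongr]
    congr 2

def foxHom (α : Type*) : FreeGroup α →*
    (Multiplicative ((α × FreeGroup α) →₀ ℤ)) ⋊[shiftHom α] (FreeGroup α) :=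
  FreeGroup.lift fun l => ⟨Multiplicative.ofAdd (Finsupp.single (l, 1) 1), FreeGroup.of l⟩

lemma foxHom_right (x : FreeGroup α) : (foxHom α x).right = x := by
  have : (SemidirectProduct.rightHom.comp (foxHom α)) = MonoidHom.id _ := by
    ext l; simp [foxHom]
  exact DFunLike.congr_fun this x

def fox (x : FreeGroup α) : (α × FreeGroup α) →₀ ℤ := Multiplicative.toAdd (foxHom α x).left

lemma fox_one : fox (1 : FreeGroup α) = 0 := by simp [fox]
lemma fox_of (l : α) : fox (FreeGroup.of l) = Finsupp.single (l, 1) 1 := by simp [fox, foxHom]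
lemma fox_mul (x y : FreeGroup α) : fox (x * y) = fox x + shiftA x (fox y) := by
  have : (foxHom α (x * y)).left = (foxHom α x).left * (shiftHom α (foxHom α x).right) (foxHom α y).left := by
    rw [map_mul]; rfl
  rw [foxHom_right] at this
  exact congrArg Multiplicative.toAdd this

lemma fox_mul_sum {N : Type*} [AddCommGroup N] (x y : FreeGroup α) (f : α × FreeGroup α → ℤ →+ N) :
    (fox (x * y)).sum (fun p c => f p c) = (fox x).sum (fun p c => f p c) +
      (fox y).sum (fun p c => f (p.1, x * p.2) c) := by
  rw [fox_mul, Finsupp.sum_add_index' (by simp) (by simp)]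
  congr 1
  simp only [shiftA, Finsupp.domCongr_apply]
  rw [Finsupp.sum_equivMapDomain]
  rfl

variable {G : Type*} [Group G]

/-- derivations -/
def IsDer (φ : FreeGroup α →* G) (D : FreeGroup α → G → ℝ) : Prop :=
  ∀ x y z, D (x * y) z = D x z + D y (z * φ x)

lemma IsDer.one {φ : FreeGroup α →* G} {D} (h : IsDer φ D) (z) : D 1 z = 0 := by
  have := h 1 1 z; simp at this; exact this

lemma IsDer.ext' {φ : FreeGroup α →* G} {D D'} (h : IsDer φ D) (h' : IsDer φ D')
    (e : ∀ l z, D (FreeGroup.of l) z = D' (FreeGroup.of l) z) (x) : ∀ z, D x z = D' x z := by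
  induction x using FreeGroup.induction_on with
  | C1 => intro z; rw [h.one, h'.one]
  | of l => exact e l
  | inv_of l _ =>
    intro z
    have a := h (FreeGroup.of l)⁻¹ (FreeGroup.of l) z
    have b := h' (FreeGroup.of l)⁻¹ (FreeGroup.of l) z
    rw [inv_mul_cancel, h.one] at a
    rw [inv_mul_cancel, h'.one, ← e] at b
    linarith
  | mul a b ha hb => intro z; rw [h, h', ha, hb]

def dv (φ : FreeGroup α →* G) (w : α × G → ℝ) (x : FreeGroup α) (z : G) : ℝ :=
  (fox x).sum fun p c => (c : ℝ) * w (p.1, z * φ p.2)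

lemma dv_isDer (φ : FreeGroup α →* G) (w : α × G → ℝ) : IsDer φ (dv φ w) := by
  intro x y z
  have := fox_mul_sum x y (fun p => (AddMonoidHom.mulRight (w (p.1, z * φ p.2))).comp (Int.castAddHom ℝ))
  simpa [dv, mul_assoc] using this

lemma dv_of (φ : FreeGroup α →* G) (w : α × G → ℝ) (l z) : dv φ w (FreeGroup.of l) z = w (l, z) := by
  simp [dv, fox_of]

lemma IsDer.eq_dv {φ : FreeGroup α →* G} {D} (h : IsDer φ D) (x z) :
    D x z = dv φ (fun p => D (FreeGroup.of p.1) p.2) x z :=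
  h.ext' (dv_isDer _ _) (fun l z => by rw [dv_of]) x z

lemma IsDer.comp_hom {γ : Type*} {φ : FreeGroup α →* G} {D} (h : IsDer φ D) (g : FreeGroup γ →* FreeGroup α) :
    IsDer (φ.comp g) (fun x => D (g x)) := by
  intro x y z; simp only [map_mul]; rw [h]; rfl

end fox

section grop
variable {I J G : Type*} [Group G]

lemma L2.sum_apply {X : Type*} {κ : Type*} (s : Finset κ) (f : κ → L2 X) (x : X) :
    (∑ i ∈ s, f i : L2 X) x = ∑ i ∈ s, f i x := by
  induction s using Finset.induction_on with
  | empty => rfl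
  | insert a s ha ih => rw [Finset.sum_insert ha, Finset.sum_insert ha, L2.add_apply, ih]

lemma inr_inj (l : I) (y : G) : Function.Injective (fun z : G => (l, z * y)) := by
  intro a b h; simpa using h
lemma inj_inj (j : J) : Function.Injective (fun z : G => (j, z)) := by
  intro a b h; simpa using h

def grop [Fintype J] (m : J → (I × G →₀ ℤ)) : L2 (I × G) →L[ℝ] L2 (J × G) :=
  ∑ j, pf (fun z : G => (j, z)) (inj_inj j) ∘L
    (∑ p ∈ (m j).support, (m j p : ℝ) • pb (fun z : G => (p.1, z * p.2)) (inr_inj p.1 p.2))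

lemma grop_apply [Fintype J] (m : J → (I × G →₀ ℤ)) (w : L2 (I × G)) (j : J) (z : G) :
    grop m w (j, z) = (m j).sum fun p c => (c : ℝ) * w (p.1, z * p.2) := by
  rw [grop, sum_apply, L2.sum_apply, Finset.sum_eq_single j]
  · rw [ContinuousLinearMap.comp_apply, pf_apply_map (fun z : G => (j, z)), sum_apply, L2.sum_apply]
    rfl
  · intro i _ hi
    rw [ContinuousLinearMap.comp_apply, pf_apply_of_notMem]
    rintro ⟨y, hy⟩
    exact hi (congrArg Prod.fst hy)
  · simp

lemma grop_eqv [Fintype J] (m : J → (I × G →₀ ℤ)) : Eqv (grop m) := by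
  intro g u
  ext ⟨j, z⟩
  rw [LT_apply, grop_apply, grop_apply]
  simp [LT_apply, mul_assoc]

end grop

section ev
variable {α J G : Type*} [Fintype J] [Group G]

def ev (φ : FreeGroup α →* G) (x : J → FreeGroup α) : L2 (α × G) →L[ℝ] L2 (J × G) :=
  grop fun j => (fox (x j)).mapDomain (fun p => (p.1, φ p.2))

lemma ev_apply (φ : FreeGroup α →* G) (x : J → FreeGroup α) (w : L2 (α × G)) (j z) :
    ev φ x w (j, z) = dv φ w (x j) z := by
  rw [ev, grop_apply, dv, Finsupp.sum_mapDomain_index (by simp) (by intros; push_cast; ring)]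

lemma ev_eqv (φ : FreeGroup α →* G) (x : J → FreeGroup α) : Eqv (ev φ x) := grop_eqv _

open ContinuousLinearMap in
/-- orthogonal complement of derivation evaluations -/
def VV (φ : FreeGroup α →* G) (x : J → FreeGroup α) : Submodule ℝ (L2 (J × G)) :=
  LinearMap.ker (adjoint (ev φ x) : L2 (J × G) →L[ℝ] L2 (α × G)).toLinearMap

open ContinuousLinearMap in
lemma mem_VV (φ : FreeGroup α →* G) (x : J → FreeGroup α) (d) : d ∈ VV φ x ↔ adjoint (ev φ x) d = 0 := Iff.rfl

open ContinuousLinearMap in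
lemma mem_VV' (φ : FreeGroup α →* G) (x : J → FreeGroup α) (d) :
    d ∈ VV φ x ↔ ∀ u, inner ℝ d (ev φ x u) = 0 := by
  rw [mem_VV]
  constructor
  · intro h u; rw [← adjoint_inner_left, h, inner_zero_left]
  · intro h; refine ext_inner_right ℝ fun v => ?_
    rw [adjoint_inner_left, h, inner_zero_left]

instance (φ : FreeGroup α →* G) (x : J → FreeGroup α) : (VV φ x).HasOrthogonalProjection := by
  have : IsClosed (VV φ x : Set (L2 (J × G))) := ContinuousLinearMap.isClosed_ker _
  have : CompleteSpace (VV φ x) := this.completeSpace_coe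
  infer_instance

def pj (φ : FreeGroup α →* G) (x : J → FreeGroup α) (j : J) : L2 (J × G) := (VV φ x).starProjection (dl (j, 1))

lemma VV_bot_of_pj (φ : FreeGroup α →* G) (x : J → FreeGroup α) (h : ∀ j, pj φ x j = 0) (d)
    (hd : d ∈ VV φ x) : d = 0 := by
  ext ⟨j, z⟩
  have h1 : LT J z d ∈ VV φ x := by
    rw [mem_VV] at hd ⊢
    rw [(ev_eqv φ x).adjoint, hd, map_zero]
  have h2 : d (j, z) = inner ℝ (dl (j, 1)) (LT J z d) := by
    rw [inner_dl, LT_apply, mul_one]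
  have h3 := Submodule.starProjection_inner_eq_zero (K := VV φ x) (dl (j, 1)) _ h1
  have h4 : (VV φ x).starProjection (dl (j, 1)) = 0 := h j
  rw [h4, sub_zero] at h3
  rw [h2, h3]; rfl

end ev
end
end S16
end

section
namespace S16
noncomputable section
open Classical
open ContinuousLinearMap

section dens
variable {α κ : Type*} [Fintype α] [Fintype κ]

/-- exponent sum -/
def es (e : κ → ℤ) : FreeGroup κ →* Multiplicative ℤ := FreeGroup.lift fun m => Multiplicative.ofAdd (e m)

lemma fox_es (e : κ → ℤ) (x : FreeGroup κ) :
    (fox x).sum (fun p c => c * e p.1) = Multiplicative.toAdd (es e x) := by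
  have hm : ∀ x y : FreeGroup κ, (fox (x * y)).sum (fun p c => c * e p.1) =
      (fox x).sum (fun p c => c * e p.1) + (fox y).sum (fun p c => c * e p.1) := fun x y =>
    fox_mul_sum x y (fun p => AddMonoidHom.mulRight (e p.1))
  let f : FreeGroup κ →* Multiplicative ℤ :=
    { toFun := fun x => Multiplicative.ofAdd ((fox x).sum (fun p c => c * e p.1))
      map_one' := by simp [fox_one]
      map_mul' := fun x y => by rw [hm]; rfl }
  have : f = es e := by
    ext l; simp [f, es, fox_of]
  exact congrArg Multiplicative.toAdd (DFunLike.congr_fun this x)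

variable (g : FreeGroup α →* FreeGroup κ) (a : FreeGroup κ →* FreeGroup α)

def gof (x : α) : FreeGroup κ := g (FreeGroup.of x)

def Eco (l : α) (m : κ) : ℤ := Multiplicative.toAdd (es (fun i => if i = l then 1 else 0) (a (FreeGroup.of m)))

lemma dens (hag : ∀ x, a (g x) = x) (d : L2 (α × FreeGroup κ))
    (hd : d ∈ VV (MonoidHom.id _) (gof g)) : d = 0 := by
  let emb : L2 (α × FreeGroup κ) →L[ℝ] L2 (κ × FreeGroup κ) :=
    grop fun m => ∑ l, Finsupp.single (l, 1) (Eco a l m)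
  have hemb : ∀ w m z, emb w (m, z) = ∑ l, (Eco a l m : ℝ) * w (l, z) := by
    intro w m z
    simp only [emb]
    rw [grop_apply, ← Finsupp.sum_finsetSum_index (by simp) (by intros; push_cast; ring)]
    refine Finset.sum_congr rfl fun l _ => ?_
    simp
  let T := ev (MonoidHom.id _) (gof g) ∘L emb
  have hT : Eqv T := (ev_eqv _ _).comp (grop_eqv _)
  let M : α → α → (FreeGroup κ →₀ ℤ) := fun i l =>
    (fox (gof g i)).sum fun p c => Finsupp.single p.2 (c * Eco a l p.1)
  have haug : ∀ i l, (M i l).sum (fun _ c => c) = if i = l then 1 else 0 := by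
    intro i l
    simp only [M]
    rw [Finsupp.sum_sum_index (by simp) (by simp)]
    simp only [Finsupp.sum_single_index]
    rw [fox_es]
    have : (es (Eco a l)) = (es (fun i => if i = l then 1 else 0)).comp a := by
      ext m; simp [es, Eco]
    rw [this, MonoidHom.comp_apply, gof, hag]
    simp [es]
  have hM : ∀ (w : L2 (α × FreeGroup κ)) i z, ∑ l, (M i l).sum (fun y c => (c : ℝ) * w (l, z * y)) = T w (i, z) := by
    intro w i z
    simp only [T, comp_apply]
    rw [ev_apply, dv]
    simp only [MonoidHom.id_apply, hemb, Finset.mul_sum, M]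
    rw [Finsupp.sum, Finset.sum_comm]
    refine Finset.sum_congr rfl fun l _ => ?_
    rw [Finsupp.sum_sum_index (by simp) (by intros; push_cast; ring)]
    rw [Finsupp.sum]
    refine Finset.sum_congr rfl fun p _ => ?_
    rw [Finsupp.sum_single_index (by simp)]
    push_cast; ring
  have inj : ∀ v, T v = 0 → v = 0 := by
    intro v hv
    have := luck M haug v (L2.summable v) (fun i z => by rw [hM, hv]; rfl)
    ext x; rw [this]; rfl
  refine (swap hT inj).2 rfl d ?_
  simp only [T, adjoint_comp, comp_apply]
  rw [(mem_VV _ _ _).1 hd, map_zero]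
end dens

section m5
variable {α κ J : Type*} [Fintype α] [Fintype κ] [Fintype J]
variable (g : FreeGroup α →* FreeGroup κ) (a : FreeGroup κ →* FreeGroup α)

def jg (J : Type*) (g : FreeGroup α →* FreeGroup κ) : J × FreeGroup α → J × FreeGroup κ := fun p => (p.1, g p.2)
lemma jg_inj (J : Type*) {g : FreeGroup α →* FreeGroup κ} (hg : Function.Injective g) : Function.Injective (jg J g) := by
  rintro ⟨a, b⟩ ⟨c, d⟩ h
  simp only [jg, Prod.mk.injEq] at h
  ext1; exacts [h.1, hg h.2]

variable {g}
lemma R1 (hg : Function.Injective g) (x : J → FreeGroup α) (u : L2 (κ × FreeGroup κ)) :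
    pb (jg J g) (jg_inj J hg) (ev (MonoidHom.id _) (g ∘ x) u) =
      ev (MonoidHom.id _) x (pb (jg α g) (jg_inj α hg) (ev (MonoidHom.id _) (gof g) u)) := by
  ext ⟨j, z⟩
  have hder : IsDer (MonoidHom.id _) (fun (y z : FreeGroup α) => dv (MonoidHom.id _) u (g y) (g z)) := by
    intro x y z
    simp only [map_mul, MonoidHom.id_apply]
    rw [dv_isDer]; rfl
  rw [pb_apply]
  change ev (MonoidHom.id _) (g ∘ x) u (j, g z) = _
  rw [ev_apply, ev_apply, Function.comp_apply, hder.eq_dv (x j) z]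
  congr 1
  funext p
  obtain ⟨l, y⟩ := p
  change _ = ev (MonoidHom.id _) (gof g) u (l, g y)
  rw [ev_apply]; rfl

lemma R2 (hg : Function.Injective g) (x : J → FreeGroup α) (u : L2 (α × FreeGroup α)) :
    pf (jg J g) (jg_inj J hg) (ev (MonoidHom.id _) x u) = ev g x (pf (jg α g) (jg_inj α hg) u) := by
  ext ⟨j, k⟩
  rw [ev_apply]
  by_cases hk : k ∈ g.range
  · obtain ⟨z, rfl⟩ := hk
    have := pf_apply_map (jg J g) (jg_inj J hg) (ev (MonoidHom.id _) x u) (j, z)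
    rw [show jg J g (j, z) = (j, g z) from rfl] at this
    rw [this, ev_apply, dv, dv]
    refine Finsupp.sum_congr fun p _ => ?_
    have := pf_apply_map (jg α g) (jg_inj α hg) u (p.1, z * p.2)
    rw [MonoidHom.id_apply, ← this, show jg α g (p.1, z * p.2) = (p.1, g z * g p.2) by simp [jg]]
  · rw [pf_apply_of_notMem, dv, Finsupp.sum, Finset.sum_eq_zero]
    · intro p _
      rw [pf_apply_of_notMem, mul_zero]
      rintro ⟨⟨l, y⟩, hy⟩
      simp only [jg, Prod.mk.injEq] at hy
      apply hk
      refine ⟨y * p.2⁻¹, ?_⟩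
      rw [map_mul, hy.2]; simp
    · rintro ⟨⟨l, y⟩, hy⟩
      simp only [jg, Prod.mk.injEq] at hy
      exact hk ⟨y, hy.2⟩

lemma R3 (x : J → FreeGroup α) (u : L2 (κ × FreeGroup κ)) :
    ev g x (ev (MonoidHom.id _) (gof g) u) = ev (MonoidHom.id _) (g ∘ x) u := by
  ext ⟨j, k⟩
  rw [ev_apply, ev_apply]
  have := ((dv_isDer (MonoidHom.id _) u).comp_hom g).eq_dv (x j) k
  rw [MonoidHom.id_comp] at this
  simp only [Function.comp_apply]
  rw [this]
  congr 1
  funext p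
  obtain ⟨l, y⟩ := p
  rw [ev_apply]; rfl

lemma VV_pf (hg : Function.Injective g) (x : J → FreeGroup α) (v) (hv : v ∈ VV (MonoidHom.id _) x) :
    pf (jg J g) (jg_inj J hg) v ∈ VV (MonoidHom.id _) (g ∘ x) := by
  rw [mem_VV'] at hv ⊢
  intro u
  rw [pf, adjoint_inner_left, R1 hg, hv]

lemma VV_pb (hg : Function.Injective g) (hag : ∀ x, a (g x) = x) (x : J → FreeGroup α) (w)
    (hw : w ∈ VV (MonoidHom.id _) (g ∘ x)) :
    pb (jg J g) (jg_inj J hg) w ∈ VV (MonoidHom.id _) x := by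
  have h1 : adjoint (ev g x) w = 0 := by
    apply dens g a hag
    rw [mem_VV']
    intro u
    rw [adjoint_inner_left, R3]
    exact (mem_VV' _ _ _).1 hw u
  rw [mem_VV']
  intro u
  have h2 : inner ℝ (pb (jg J g) (jg_inj J hg) w) (ev (MonoidHom.id _) x u) =
      inner ℝ w (pf (jg J g) (jg_inj J hg) (ev (MonoidHom.id _) x u)) := by
    rw [pf, adjoint_inner_right]
  rw [h2, R2 hg, ← adjoint_inner_left, h1, inner_zero_left]

lemma pj_pf (hg : Function.Injective g) (hag : ∀ x, a (g x) = x) (x : J → FreeGroup α) (j : J) :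
    pf (jg J g) (jg_inj J hg) (pj (MonoidHom.id _) x j) = pj (MonoidHom.id _) (g ∘ x) j := by
  refine (Submodule.eq_starProjection_of_mem_of_inner_eq_zero ?_ ?_).symm
  · exact VV_pf hg x _ (Submodule.starProjection_apply_mem _ _)
  · intro w hw
    have e : (dl (j, 1) : L2 (J × FreeGroup κ)) = pf (jg J g) (jg_inj J hg) (dl (j, 1)) := by
      rw [pf_dl]; simp [jg]
    rw [e, ← map_sub, pf, adjoint_inner_left]
    exact Submodule.starProjection_inner_eq_zero _ _ (VV_pb a hg hag x w hw)

/-- injectivity of evaluation from triviality of VV -/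
lemma ev_inj (x : α → FreeGroup α) (h : ∀ d ∈ VV (MonoidHom.id _) x, d = 0)
    (w) (hw : ev (MonoidHom.id _) x w = 0) : w = 0 := by
  have h2 := (swap (T := adjoint (ev (MonoidHom.id _) x)) (ev_eqv _ x).adjoint h).2 rfl w
  rw [adjoint_adjoint] at h2
  exact h2 hw

end m5
end
end S16
end

section
namespace S16
noncomputable section
open Classical
open ContinuousLinearMap

lemma L2.level_finite {X : Type*} (v : L2 X) (t : ℝ) (ht : t ≠ 0) : {x | v x = t}.Finite := by
  have h := (L2.summable v).tendsto_cofinite_zero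
  have h2 := h.eventually (gt_mem_nhds (by positivity : 0 < t ^ 2))
  rw [Filter.eventually_cofinite] at h2
  refine h2.subset fun x hx => ?_
  simp only [Set.mem_setOf_eq] at hx ⊢
  rw [hx]; simp

section periodic
variable {F K : Type*} [Group F] [Group K] (g h : F →* K) (b : K →* F)

/-- points with periodic chains -/
def PP : Subgroup F where
  carrier := {x | (∀ i, g ((b.comp g)^[i] x) = h ((b.comp g)^[i + 1] x)) ∧ ∃ m, 0 < m ∧ (b.comp g)^[m] x = x}
  one_mem' := by
    refine ⟨fun i => ?_, 1, one_pos, by simp⟩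
    rw [iterate_map_one, iterate_map_one]; simp
  mul_mem' := by
    rintro x y ⟨hx, m, hm, hxm⟩ ⟨hy, n, hn, hyn⟩
    refine ⟨fun i => ?_, m * n, Nat.mul_pos hm hn, ?_⟩
    · rw [iterate_map_mul, iterate_map_mul, map_mul, map_mul, hx, hy]
    · rw [iterate_map_mul]
      have h1 : Function.IsPeriodicPt (b.comp g) m x := hxm
      have h2 : Function.IsPeriodicPt (b.comp g) n y := hyn
      rw [(h1.mul_const n).eq, (h2.const_mul m).eq]
  inv_mem' := by
    rintro x ⟨hx, m, hm, hxm⟩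
    refine ⟨fun i => ?_, m, hm, ?_⟩
    · rw [iterate_map_inv, iterate_map_inv, map_inv, map_inv, hx]
    · rw [iterate_map_inv, hxm]

variable {g h b}
lemma mem_PP {x : F} : x ∈ PP g h b ↔ (∀ i, g ((b.comp g)^[i] x) = h ((b.comp g)^[i + 1] x)) ∧ ∃ m, 0 < m ∧ (b.comp g)^[m] x = x := Iff.rfl

lemma PP_step {x : F} (hx : x ∈ PP g h b) : b.comp g x ∈ PP g h b := by
  obtain ⟨h1, m, hm, h2⟩ := hx
  refine ⟨fun i => ?_, m, hm, ?_⟩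
  · have := h1 (i + 1)
    rwa [Function.iterate_succ_apply, Function.iterate_succ_apply _ (i + 1)] at this
  · rw [← Function.iterate_succ_apply, Function.iterate_succ_apply', h2]

lemma eqLocus_le_PP (hbh : ∀ x, b (h x) = x) {x : F} (hx : g x = h x) : x ∈ PP g h b ∧ b.comp g x = x := by
  have h1 : b.comp g x = x := by rw [MonoidHom.comp_apply, hx, hbh]
  have h2 : ∀ i, (b.comp g)^[i] x = x := fun i => Function.iterate_fixed h1 i
  refine ⟨⟨fun i => by rw [h2, h2, hx], 1, one_pos, h1⟩, h1⟩
end periodic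

section supp
variable {α κ J : Type*} [Fintype α] [Fintype κ] [Fintype J]
variable {g h : FreeGroup α →* FreeGroup κ} {a b : FreeGroup κ →* FreeGroup α}

lemma inj_of_retr {F K : Type*} [Group F] [Group K] {g : F →* K} {a : K →* F} (hag : ∀ x, a (g x) = x) :
    Function.Injective g := fun x y hxy => by rw [← hag x, hxy, hag]

lemma pj_step (hag : ∀ x, a (g x) = x) (hbh : ∀ x, b (h x) = x) (x y : J → FreeGroup α)
    (hxy : ∀ j, g (x j) = h (y j)) (j0 : J) :
    pf (jg J g) (jg_inj J (inj_of_retr hag)) (pj (MonoidHom.id _) x j0) =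
    pf (jg J h) (jg_inj J (inj_of_retr hbh)) (pj (MonoidHom.id _) y j0) := by
  rw [pj_pf a (inj_of_retr hag) hag, pj_pf b (inj_of_retr hbh) hbh]
  congr 1
  funext j; exact hxy j

lemma pj_supp (hag : ∀ x, a (g x) = x) (hbh : ∀ x, b (h x) = x) (x : J → FreeGroup α)
    (hx : ∀ j, x j ∈ PP g h b) (j0 j : J) (z : FreeGroup α)
    (hz : pj (MonoidHom.id _) x j0 (j, z) ≠ 0) : z ∈ PP g h b := by
  choose h1 m hm hper using hx
  let σ := b.comp g
  let v : ℕ → L2 (J × FreeGroup α) := fun i => pj (MonoidHom.id _) (fun j => σ^[i] (x j)) j0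
  set t := pj (MonoidHom.id _) x j0 (j, z) with ht
  have step : ∀ i y, v i (j, y) = t → g y = h (σ y) ∧ v (i + 1) (j, σ y) = t := by
    intro i y hy
    have e := pj_step hag hbh (fun j => σ^[i] (x j)) (fun j => σ^[i + 1] (x j)) (fun j => h1 j i) j0
    have e1 := pf_apply_map (jg J g) (jg_inj J (inj_of_retr hag)) (v i) (j, y)
    rw [hy] at e1
    change pf (jg J g) _ (v i) = pf (jg J h) _ (v (i + 1)) at e
    rw [e] at e1
    by_cases hr : jg J g (j, y) ∈ Set.range (jg J h)
    · obtain ⟨⟨j', y'⟩, hy'⟩ := hr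
      have hy2 := hy'
      simp only [jg, Prod.mk.injEq] at hy2
      obtain ⟨rfl, hy3⟩ := hy2
      have : σ y = y' := by
        change b (g y) = y'
        rw [← hy3, hbh]
      rw [this, hy3]
      refine ⟨rfl, ?_⟩
      rw [← hy', pf_apply_map] at e1
      exact e1
    · rw [pf_apply_of_notMem _ _ _ _ hr] at e1
      exact absurd e1.symm hz
  have hv0 : ∀ i, v i (j, σ^[i] z) = t := by
    intro i
    induction i with
    | zero => rfl
    | succ i ih => rw [Function.iterate_succ_apply']; exact (step i _ ih).2
  have hchain : ∀ i, g (σ^[i] z) = h (σ^[i + 1] z) := by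
    intro i; rw [Function.iterate_succ_apply']; exact (step i _ (hv0 i)).1
  refine ⟨hchain, ?_⟩
  let N := ∏ j, m j
  have hN : 0 < N := Finset.prod_pos fun j _ => hm j
  have hvN : ∀ i, v (i * N) = v 0 := by
    intro i
    simp only [v]
    congr 1
    funext j
    have p1 : Function.IsPeriodicPt σ (m j) (x j) := hper j
    have p2 : Function.IsPeriodicPt σ (i * N) (x j) :=
      p1.trans_dvd ((Finset.dvd_prod_of_mem m (Finset.mem_univ j)).mul_left i)
    exact p2.eq
  have hfin := L2.level_finite (v 0) t hz
  have hni : ¬ Function.Injective (fun i => (⟨(j, σ^[i * N] z), by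
      have := hv0 (i * N); rw [hvN] at this; exact this⟩ : {p | v 0 p = t})) := by
    have := hfin.to_subtype
    exact not_injective_infinite_finite _
  have desc : ∀ k i i', σ^[i + k] z = σ^[i' + k] z → σ^[i] z = σ^[i'] z := by
    intro k
    induction k with
    | zero => intro i i' hh; exact hh
    | succ k ih =>
      intro i i' hh
      apply ih
      have a1 := hchain (i + k)
      have a2 := hchain (i' + k)
      rw [← add_assoc, ← add_assoc] at hh
      rw [hh, ← a2] at a1
      exact inj_of_retr hag a1
  rw [Function.Injective] at hni
  push Not at hni
  obtain ⟨i, i', he0, hne⟩ := hni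
  have he : σ^[i * N] z = σ^[i' * N] z := by simpa using he0
  clear he0
  wlog hlt : i < i' generalizing i i'
  · exact this i' i hne.symm he.symm (lt_of_le_of_ne (not_lt.1 hlt) hne.symm)
  refine ⟨i' * N - i * N, Nat.sub_pos_of_lt (Nat.mul_lt_mul_of_pos_right hlt hN), ?_⟩
  have := desc (i * N) 0 (i' * N - i * N) (by
    rw [zero_add, Nat.sub_add_cancel (Nat.mul_le_mul_right _ hlt.le), he])
  exact this.symm
end supp

section m6
variable {α J : Type*} [Fintype α] [Fintype J]

lemma dv_fin {ι : Type*} (l0 : ι) (x0 q : FreeGroup ι) :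
    {z | dv (MonoidHom.id _) (fun p : ι × FreeGroup ι => if p = (l0, x0) then 1 else 0) q z ≠ 0}.Finite := by
  refine ((fox q).support.image (fun p => x0 * p.2⁻¹)).finite_toSet.subset ?_
  intro z hz
  simp only [Set.mem_setOf_eq, dv, Finsupp.sum] at hz
  obtain ⟨p, hp, hpz⟩ := Finset.exists_ne_zero_of_sum_ne_zero hz
  simp only [Finset.coe_image, Set.mem_image]
  refine ⟨p, hp, ?_⟩
  by_contra hne
  apply hpz
  rw [if_neg, mul_zero]
  intro h
  apply hne
  simp only [Prod.mk.injEq, MonoidHom.id_apply] at h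
  rw [← h.2]; simp

lemma exists_transversal {F : Type*} [Group F] (P : Subgroup F) : ∃ t : F → F,
    (∀ p ∈ P, ∀ f, t (p * f) = t f) ∧ (∀ f, f * (t f)⁻¹ ∈ P) ∧ ∀ p ∈ P, t p = 1 := by
  let s := QuotientGroup.rightRel P
  have hs : ∀ x y : F, s x y ↔ y * x⁻¹ ∈ P := fun x y => QuotientGroup.rightRel_apply
  refine ⟨fun f => if f ∈ P then 1 else (Quotient.mk s f).out, ?_, ?_, ?_⟩
  · intro p hp f
    have h1 : p * f ∈ P ↔ f ∈ P := P.mul_mem_cancel_left hp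
    have h2 : Quotient.mk s (p * f) = Quotient.mk s f := by
      apply Quotient.sound
      change s _ _
      rw [hs]; simpa using hp
    simp only [h1, h2]
  · intro f
    by_cases hf : f ∈ P
    · simpa [hf] using hf
    · simp only [hf, if_false]
      have : s (Quotient.mk s f).out f := Quotient.exact (Quotient.out_eq _)
      rwa [hs] at this
  · intro p hp; simp [hp]

lemma m6 {ι : Type*} (P : Subgroup (FreeGroup α)) (B : FreeGroupBasis ι P) (e : J → ι)
    (he : Function.Injective e) (d : L2 (J × FreeGroup α))
    (hd : d ∈ VV (MonoidHom.id _) (fun j => (B (e j) : FreeGroup α)))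
    (hsupp : ∀ j z, d (j, z) ≠ 0 → z ∈ P) : d = 0 := by
  ext ⟨j0, x0⟩
  by_contra hne
  have hx0 : x0 ∈ P := hsupp j0 x0 hne
  let Φ : P ≃* FreeGroup ι := B.repr
  let w0 : ι × FreeGroup ι → ℝ := fun p => if p = (e j0, Φ ⟨x0, hx0⟩) then 1 else 0
  let D0 : FreeGroup ι → FreeGroup ι → ℝ := dv (MonoidHom.id _) w0
  have hD0 : IsDer (MonoidHom.id _) D0 := dv_isDer _ _
  let u : FreeGroup ι → ℝ := fun y => D0 y 1
  have hu : ∀ z y, u (z * y) - u z = D0 y z := by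
    intro z y
    simp only [u]; rw [hD0]; simp
  obtain ⟨t, ht1, ht2, ht3⟩ := exists_transversal P
  let U : FreeGroup α → ℝ := fun f => u (Φ ⟨f * (t f)⁻¹, ht2 f⟩)
  have hUP : ∀ p : P, U p = u (Φ p) := by
    intro p
    simp only [U]
    congr 2
    apply Subtype.ext
    simp [ht3 p p.2]
  let Δ : FreeGroup α → FreeGroup α → ℝ := fun y z => U (z * y) - U z
  have hΔ : IsDer (MonoidHom.id _) Δ := by
    intro x y z
    simp only [Δ, MonoidHom.id_apply, mul_assoc]; ring
  let T0 : Finset (FreeGroup α) := (Finset.univ.biUnion fun j => (fox (B (e j) : FreeGroup α)).support).image (fun p => t p.2)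
  let w : α × FreeGroup α → ℝ := fun p => if t p.2 ∈ T0 then Δ (FreeGroup.of p.1) p.2 else 0
  -- finite support
  have hΔfin : ∀ y s, {z | t z = s ∧ Δ y z ≠ 0}.Finite := by
    intro y s
    by_cases hs : s = t s
    swap
    · convert Set.finite_empty
      ext z
      simp only [Set.mem_setOf_eq, Set.mem_empty_iff_false, iff_false, not_and]
      intro hz
      exfalso; apply hs
      have h1 := ht1 (z * (t z)⁻¹) (ht2 z) (t z)
      rw [inv_mul_cancel_right] at h1
      rw [hz] at h1; exact h1
    let q : P := ⟨(s * y) * (t (s * y))⁻¹, ht2 _⟩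
    have hf := dv_fin (e j0) (Φ ⟨x0, hx0⟩) (Φ q)
    refine (hf.image (fun p => ((Φ.symm p : P) : FreeGroup α) * s)).subset ?_
    rintro z ⟨hz1, hz2⟩
    refine ⟨Φ ⟨z * (t z)⁻¹, ht2 z⟩, ?_, by simp [hz1]⟩
    change D0 (Φ q) _ ≠ 0
    rw [← hu]
    convert hz2 using 1
    simp only [Δ, U]
    rw [← map_mul]
    congr 3
    apply Subtype.ext
    have h2 : t (z * y) = t (s * y) := by
      have := ht1 (z * (t z)⁻¹) (ht2 z) (s * y)
      rw [← this, hz1]; simp [mul_assoc]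
    simp only [q, Subgroup.coe_mul]
    rw [h2, hz1]; simp [mul_assoc]
  have hwfin : (Function.support w).Finite := by
    have : (⋃ l : α, ⋃ s ∈ T0, (fun z => (l, z)) '' {z | t z = s ∧ Δ (FreeGroup.of l) z ≠ 0}).Finite :=
      Set.finite_iUnion fun l => T0.finite_toSet.biUnion fun s _ => (hΔfin _ s).image _
    refine this.subset ?_
    rintro ⟨l, z⟩ hz
    simp only [Function.mem_support, w] at hz
    by_cases hT : t z ∈ T0
    · rw [if_pos hT] at hz
      simp only [Set.mem_iUnion]
      exact ⟨l, t z, hT, z, ⟨rfl, hz⟩, rfl⟩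
    · rw [if_neg hT] at hz; exact absurd rfl hz
  have hwsum : Summable fun p => w p ^ 2 := by
    refine summable_of_finite_support (hwfin.subset ?_)
    intro p hp hp2
    apply hp
    simp only [hp2]; simp
  have hloc : ∀ j, ∀ z ∈ P, dv (MonoidHom.id _) w (B (e j) : FreeGroup α) z = if (j, z) = (j0, x0) then 1 else 0 := by
    intro j z hz
    have e1 : dv (MonoidHom.id _) w (B (e j) : FreeGroup α) z = Δ (B (e j) : FreeGroup α) z := by
      rw [hΔ.eq_dv, dv, dv]
      refine Finsupp.sum_congr fun p hp => ?_
      congr 1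
      simp only [w, MonoidHom.id_apply]
      rw [if_pos]
      rw [ht1 z hz]
      exact Finset.mem_image.2 ⟨p, Finset.mem_biUnion.2 ⟨j, Finset.mem_univ _, hp⟩, rfl⟩
    rw [e1]
    simp only [Δ]
    have e2 := hUP (⟨z, hz⟩ * B (e j))
    have e3 := hUP ⟨z, hz⟩
    rw [Subgroup.coe_mul] at e2
    rw [e2, e3, map_mul, hu]
    have : Φ (B (e j)) = FreeGroup.of (e j) := B.repr_apply_coe _
    rw [this]
    simp only [D0]
    rw [dv_of]
    simp only [w0, Prod.mk.injEq, he.eq_iff, Φ.injective.eq_iff, Subtype.mk.injEq]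
  have h0 := (mem_VV' _ _ _).1 hd (L2.mk w hwsum)
  rw [L2.inner_eq, tsum_eq_single (j0, x0)] at h0
  · rw [ev_apply] at h0
    have := hloc j0 x0 hx0
    rw [if_pos rfl] at this
    change d (j0, x0) * dv _ w _ _ = 0 at h0
    rw [this, mul_one] at h0
    exact hne h0
  · rintro ⟨j, z⟩ hjz
    by_cases hz : z ∈ P
    · rw [ev_apply]
      change d (j, z) * dv _ w _ _ = 0
      rw [hloc j z hz, if_neg hjz, mul_zero]
    · have : d (j, z) = 0 := by
        by_contra hh; exact hz (hsupp j z hh)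
      rw [this, zero_mul]
end m6
end
end S16
end

section
namespace S16
noncomputable section
open Classical
open ContinuousLinearMap

section count
variable {α κ : Type*} [Fintype α] [Fintype κ]
variable {g h : FreeGroup α →* FreeGroup κ} {a b : FreeGroup κ →* FreeGroup α}

lemma der_zero (hag : ∀ x, a (g x) = x) (x : α → FreeGroup α)
    (hV : ∀ d ∈ VV (MonoidHom.id _) x, d = 0) (v : L2 (κ × FreeGroup κ))
    (hv : ev (MonoidHom.id _) (g ∘ x) v = 0) (y : FreeGroup α) (k : FreeGroup κ) :
    dv (MonoidHom.id _) v (g y) k = 0 := by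
  have h1 : ∀ l k, dv (MonoidHom.id _) v (g (FreeGroup.of l)) k = 0 := by
    intro l k
    have r := R1 (inj_of_retr hag) x (LT κ k v)
    rw [ev_eqv, hv, map_zero, map_zero] at r
    have r2 := ev_inj x hV _ r.symm
    have r3 := congrArg (fun u : L2 _ => u (l, 1)) r2
    simp only [pb_apply, L2.zero_apply] at r3
    change ev (MonoidHom.id _) (gof g) (LT κ k v) (l, g 1) = 0 at r3
    rw [ev_eqv, LT_apply, map_one, mul_one, ev_apply] at r3
    exact r3
  have hz : IsDer g (fun _ _ => (0 : ℝ)) := by intro x y z; simp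
  have hd := (dv_isDer (MonoidHom.id _) v).comp_hom g
  rw [MonoidHom.id_comp] at hd
  exact hd.ext' hz h1 y k

lemma count (hag : ∀ x, a (g x) = x) (hbh : ∀ x, b (h x) = x) (htop : g.range ⊔ h.range = ⊤)
    (hne : g.range ≠ h.range) {ι : Type*} (B : FreeGroupBasis ι (PP g h b)) (e : α ↪ ι) : False := by
  let x : α → FreeGroup α := fun j => (B (e j) : FreeGroup α)
  have hx : ∀ j, x j ∈ PP g h b := fun j => (B (e j)).2
  have hpx : ∀ j, pj (MonoidHom.id _) x j = 0 := by
    intro j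
    refine m6 (PP g h b) B e e.injective _ (Submodule.starProjection_apply_mem _ _) ?_
    intro j' z hz
    exact pj_supp hag hbh x hx j j' z hz
  have hVx := VV_bot_of_pj (MonoidHom.id _) x hpx
  let y : α → FreeGroup α := fun j => b.comp g (x j)
  have hxy : ∀ j, g (x j) = h (y j) := fun j => (hx j).1 0
  have hpy : ∀ j, pj (MonoidHom.id _) y j = 0 := by
    intro j
    have := pj_step hag hbh x y hxy j
    rw [hpx, map_zero] at this
    ext p
    rw [← pf_apply_map (jg α h) (jg_inj α (inj_of_retr hbh)), ← this]; rfl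
  have hVy := VV_bot_of_pj (MonoidHom.id _) y hpy
  have hgx : g ∘ x = h ∘ y := funext hxy
  have inj : ∀ v, ev (MonoidHom.id _) (g ∘ x) v = 0 → v = 0 := by
    intro v hv
    have d1 := der_zero hag x hVx v hv
    have d2 := der_zero hbh y hVy v (hgx ▸ hv)
    have hD := dv_isDer (MonoidHom.id (FreeGroup κ)) v
    let S : Subgroup (FreeGroup κ) :=
      { carrier := {x | ∀ z, dv (MonoidHom.id _) v x z = 0}
        one_mem' := hD.one
        mul_mem' := fun {p q} hp hq z => by rw [hD, hp, hq, add_zero]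
        inv_mem' := fun {p} hp z => by
          have := hD p⁻¹ p z
          rw [inv_mul_cancel, hD.one, hp, add_zero] at this
          exact this.symm }
    have hS : S = ⊤ := by
      rw [eq_top_iff, ← htop]
      refine sup_le ?_ ?_
      · rintro _ ⟨q, rfl⟩; exact d1 q
      · rintro _ ⟨q, rfl⟩; exact d2 q
    ext ⟨l, z⟩
    have : FreeGroup.of l ∈ S := hS ▸ Subgroup.mem_top _
    rw [← dv_of (MonoidHom.id _) v l z, this z]; rfl
  have hcard := (swap (ev_eqv (MonoidHom.id _) (g ∘ x)) inj).1
  -- surjection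
  have hsurj : ∀ (a : FreeGroup κ →* FreeGroup α) (g : FreeGroup α →* FreeGroup κ), (∀ x, a (g x) = x) → g.range = ⊤ := by
    intro a g hag
    obtain ⟨f⟩ := Function.Embedding.nonempty_of_card_le hcard
    let s : FreeGroup α →* FreeGroup κ := FreeGroup.lift fun l => if hl : ∃ m, f m = l then FreeGroup.of hl.choose else 1
    have hs : Function.Surjective s := by
      rw [← MonoidHom.range_eq_top, eq_top_iff, ← FreeGroup.closure_range_of, Subgroup.closure_le]
      rintro _ ⟨m, rfl⟩
      refine ⟨FreeGroup.of (f m), ?_⟩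
      have hex : ∃ m', f m' = f m := ⟨m, rfl⟩
      simp only [s, FreeGroup.lift_apply_of]
      rw [dif_pos hex]
      congr 1
      exact f.injective hex.choose_spec
    have ha : Function.Surjective a := fun x => ⟨g x, hag x⟩
    have hi := hopf (a.comp s) (ha.comp hs)
    have hai : Function.Injective a := by
      intro p q hpq
      obtain ⟨p, rfl⟩ := hs p
      obtain ⟨q, rfl⟩ := hs q
      rw [hi hpq]
    rw [MonoidHom.range_eq_top]
    intro k
    exact ⟨a k, hai (hag _)⟩
  exact hne ((hsurj a g hag).trans (hsurj b h hbh).symm)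
end count
end
end S16
end

section
open Classical
noncomputable section
namespace S16

section word
variable {ι : Type*}

def lt1 (l : ι × Bool) : FreeGroup ι := FreeGroup.mk [l]

lemma lt1_inv (l : ι × Bool) : (lt1 l)⁻¹ = lt1 (l.1, !l.2) := by
  simp [lt1, FreeGroup.inv_mk, FreeGroup.invRev]

lemma toWord_mk_red {L : List (ι × Bool)} (h : FreeGroup.IsReduced L) :
    (FreeGroup.mk L).toWord = L := by
  rw [FreeGroup.toWord_mk, h.reduce_eq]

lemma word_step (u : FreeGroup ι) (l : ι × Bool) :
    (u * lt1 l).toWord = u.toWord ++ [l] ∨ ∃ c, u.toWord = (u * lt1 l).toWord ++ [c] := by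
  have hu : FreeGroup.IsReduced u.toWord := FreeGroup.isReduced_toWord
  have e : u * lt1 l = FreeGroup.mk (u.toWord ++ [l]) := by
    conv_lhs => rw [← FreeGroup.mk_toWord (x := u)]
    rfl
  rcases List.eq_nil_or_concat u.toWord with h0 | ⟨w, c, hw⟩
  · left; rw [e, h0, toWord_mk_red]; simp
  · rw [List.concat_eq_append] at hw
    by_cases hc : c.1 = l.1 → c.2 = l.2
    · left
      rw [e, toWord_mk_red]
      unfold FreeGroup.IsReduced at *
      rw [hw] at hu ⊢
      rw [List.isChain_append]
      refine ⟨hu, by simp, ?_⟩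
      simp
      exact hc
    · right
      push Not at hc
      refine ⟨c, ?_⟩
      have : u * lt1 l = FreeGroup.mk w := by
        rw [e, hw]
        have : c = (l.1, !l.2) := by
          rcases c with ⟨c1, c2⟩; rcases l with ⟨l1, l2⟩
          simp at hc ⊢
          refine ⟨hc.1, ?_⟩
          have := hc.2
          cases c2 <;> cases l2 <;> simp_all
        rw [this]
        have h2 : FreeGroup.mk (w ++ [(l.1, !l.2)] ++ [l]) = FreeGroup.mk w * (lt1 (l.1, !l.2) * lt1 l) := by
          simp [lt1, FreeGroup.mul_mk]
        rw [h2, ← lt1_inv]; simp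
      rw [this, toWord_mk_red, hw]
      rw [hw] at hu
      exact hu.infix ⟨[], [c], by simp⟩

lemma word_head : ∀ (L : List (ι × Bool)) (u : FreeGroup ι), L.length < u.norm →
    (u * FreeGroup.mk L).toWord.head? = u.toWord.head? := by
  intro L
  induction L with
  | nil => intro u _; rw [← FreeGroup.one_eq_mk, mul_one]
  | cons l L ih =>
    intro u hu
    have e : u * FreeGroup.mk (l :: L) = (u * lt1 l) * FreeGroup.mk L := by
      rw [mul_assoc, lt1, FreeGroup.mul_mk]; rfl
    simp only [List.length_cons, FreeGroup.norm] at hu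
    rcases word_step u l with h | ⟨c, h⟩
    · rw [e, ih, h]
      · cases h' : u.toWord with
        | nil => rw [h'] at hu; simp at hu
        | cons a b => simp
      · simp [FreeGroup.norm, h]; omega
    · rw [h] at hu
      simp at hu
      rw [e, ih, h]
      · cases h' : (u * lt1 l).toWord with
        | nil => rw [h'] at hu; simp at hu
        | cons a b => simp
      · simp only [FreeGroup.norm]; omega

lemma word_head' (u v : FreeGroup ι) (h : v.norm < u.norm) :
    (u * v).toWord.head? = u.toWord.head? := by
  have := word_head v.toWord u h
  rwa [FreeGroup.mk_toWord] at this

lemma word_cons (u : FreeGroup ι) (l : ι × Bool) (h : u.toWord.head? ≠ some l) :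
    ((lt1 l)⁻¹ * u).toWord = (l.1, !l.2) :: u.toWord := by
  have hu : FreeGroup.IsReduced u.toWord := FreeGroup.isReduced_toWord
  have e : (lt1 l)⁻¹ * u = FreeGroup.mk ((l.1, !l.2) :: u.toWord) := by
    conv_lhs => rw [← FreeGroup.mk_toWord (x := u), lt1_inv, lt1, FreeGroup.mul_mk]
    rfl
  rw [e, toWord_mk_red]
  unfold FreeGroup.IsReduced at *
  rw [List.isChain_cons]
  refine ⟨?_, hu⟩
  intro y hy
  rcases y with ⟨y1, y2⟩; rcases l with ⟨l1, l2⟩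
  simp at hy h ⊢
  rintro rfl
  rw [hy] at h
  cases y2 <;> cases l2 <;> simp_all

lemma ball_fin [Finite ι] (N : ℕ) : {u : FreeGroup ι | u.norm ≤ N}.Finite := by
  have : {w : List (ι × Bool) | w.length ≤ N}.Finite := List.finite_length_le _ _
  exact Set.Finite.of_finite_image (f := FreeGroup.toWord)
    (this.subset (by rintro _ ⟨u, hu, rfl⟩; exact hu)) (FreeGroup.toWord_injective.injOn)

lemma lt1_induct {C : FreeGroup ι → Prop} (h1 : C 1)
    (h : ∀ x l, C x → C (x * lt1 l)) (x : FreeGroup ι) : C x := by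
  have : ∀ L : List (ι × Bool), C (FreeGroup.mk L) := by
    intro L
    induction L using List.reverseRecOn with
    | nil => exact h1
    | append_singleton L l ih =>
      have := h _ l ih
      rwa [lt1, FreeGroup.mul_mk] at this
  have := this x.toWord
  rwa [FreeGroup.mk_toWord] at this
end word
end S16
end
end

section
open Classical
noncomputable section
namespace S16

section fm
variable {P : Type*} [Group P]

def FinMod (H : Subgroup P) (A : Set P) : Prop :=
  ∃ t : Set P, t.Finite ∧ ∀ x ∈ A, ∃ h ∈ H, ∃ y ∈ t, x = h * y

variable {H : Subgroup P}

lemma FinMod.mono {A B : Set P} (hB : FinMod H B) (h : A ⊆ B) : FinMod H A := by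
  obtain ⟨t, ht, hx⟩ := hB
  exact ⟨t, ht, fun x hxA => hx x (h hxA)⟩

lemma FinMod.union {A B : Set P} (hA : FinMod H A) (hB : FinMod H B) : FinMod H (A ∪ B) := by
  obtain ⟨t, ht, hx⟩ := hA
  obtain ⟨s, hs, hy⟩ := hB
  refine ⟨t ∪ s, ht.union hs, ?_⟩
  rintro x (h | h)
  · obtain ⟨h, hh, y, hy, e⟩ := hx x h
    exact ⟨h, hh, y, Or.inl hy, e⟩
  · obtain ⟨h, hh, y, hy, e⟩ := hy x h
    exact ⟨h, hh, y, Or.inr hy, e⟩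

lemma FinMod.right {A : Set P} (hA : FinMod H A) (l : P) : FinMod H {x | x * l ∈ A} := by
  obtain ⟨t, ht, hx⟩ := hA
  refine ⟨(fun y => y * l⁻¹) '' t, ht.image _, ?_⟩
  intro x h
  obtain ⟨h, hh, y, hy, e⟩ := hx _ h
  exact ⟨h, hh, _, ⟨y, hy, rfl⟩, by rw [← mul_assoc, ← e]; group⟩

section flow
variable {Λ : Type*} {lam : Λ → P} {T : P → P} {Bd : Set P}

lemma eqv_iter {T : P → P} (hT : ∀ h ∈ H, ∀ x, T (h * x) = h * T x) {h : P} (hh : h ∈ H) (x : P)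
    (n : ℕ) : T^[n] (h * x) = h * T^[n] x := by
  induction n generalizing x with
  | zero => rfl
  | succ n ih => rw [Function.iterate_succ_apply, hT h hh, ih, Function.iterate_succ_apply]

lemma per_iter {T : P → P} (hT : ∀ h ∈ H, ∀ x, T (h * x) = h * T x) {h : P} (hh : h ∈ H) (x : P)
    (k : ℕ) (e : T^[k] x = h * x) (j : ℕ) : T^[k * j] x = h ^ j * x := by
  induction j with
  | zero => simp
  | succ j ih =>
    rw [Nat.mul_succ, add_comm, Function.iterate_add_apply, ih, eqv_iter hT (H.pow_mem hh j), e, pow_succ,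
      mul_assoc]

def appr (H : Subgroup P) (T : P → P) (x y : P) : Prop :=
  ∃ h ∈ H, ∃ m n : ℕ, h * T^[m] x = T^[n] y

lemma appr_symm {x y : P} (h : appr H T x y) : appr H T y x := by
  obtain ⟨h, hh, m, n, e⟩ := h
  exact ⟨h⁻¹, H.inv_mem hh, n, m, by rw [← e]; group⟩

lemma appr_trans (hT : ∀ h ∈ H, ∀ x, T (h * x) = h * T x) {x y z : P} (h1 : appr H T x y)
    (h2 : appr H T y z) : appr H T x z := by
  obtain ⟨h, hh, m, n, e⟩ := h1
  obtain ⟨k, hk, a, b, e'⟩ := h2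
  refine ⟨k * h, H.mul_mem hk hh, a + m, n + b, ?_⟩
  rw [Function.iterate_add_apply, mul_assoc, ← eqv_iter hT hh, e, Function.iterate_add_apply, ← e',
    eqv_iter hT hk, ← Function.iterate_add_apply, ← Function.iterate_add_apply, add_comm]

lemma exists_R (hT : ∀ h ∈ H, ∀ x, T (h * x) = h * T x) (hBd : FinMod H Bd)
    (hedge : ∀ x l, x ∉ Bd → T x = x * lam l ∨ T (x * lam l) = x)
    (hind : ∀ C : P → Prop, C 1 → (∀ x l, C x → C (x * lam l)) → ∀ x, C x) :
    ∃ R : Set P, (∀ h ∈ H, ∀ x ∈ R, h * x ∈ R) ∧ FinMod H R ∧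
      ∀ x, (∃ k, 0 < k ∧ ∃ h ∈ H, T^[k] x = h * x) → ∃ j, T^[j] x ∈ R := by
  obtain ⟨t, ht, hBt⟩ := hBd
  have hcov : ∀ x, ∃ y ∈ insert 1 t, appr H T x y := by
    intro x
    by_cases hb : ∃ z ∈ Bd, appr H T x z
    · obtain ⟨z, hz, e⟩ := hb
      obtain ⟨h, hh, y, hy, rfl⟩ := hBt z hz
      refine ⟨y, Or.inr hy, appr_trans hT e ⟨h⁻¹, H.inv_mem hh, 0, 0, ?_⟩⟩
      simp
    · push Not at hb
      refine ⟨1, Or.inl rfl, ?_⟩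
      have := hind (fun y => appr H T x (x * y)) ⟨1, H.one_mem, 0, 0, by simp⟩ ?_ x⁻¹
      · simpa using this
      · intro y l hy
        have hnb : x * y ∉ Bd := fun h => hb _ h hy
        refine appr_trans hT hy ?_
        rw [← mul_assoc]
        rcases hedge _ l hnb with e | e
        · exact ⟨1, H.one_mem, 1, 0, by simp [e]⟩
        · exact ⟨1, H.one_mem, 0, 1, by simp [e]⟩
  have hr : ∀ y, ∃ z, (∃ x, (∃ k, 0 < k ∧ ∃ h ∈ H, T^[k] x = h * x) ∧ appr H T x y) →
      ((∃ k, 0 < k ∧ ∃ h ∈ H, T^[k] z = h * z) ∧ appr H T z y) := by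
    intro y
    by_cases h : ∃ x, (∃ k, 0 < k ∧ ∃ h ∈ H, T^[k] x = h * x) ∧ appr H T x y
    · obtain ⟨x, hx⟩ := h
      exact ⟨x, fun _ => hx⟩
    · exact ⟨1, fun h' => absurd h' h⟩
  choose r hr using hr
  refine ⟨{x | ∃ h ∈ H, ∃ y ∈ insert 1 t, x = h * r y}, ?_, ?_, ?_⟩
  · rintro h hh _ ⟨k, hk, y, hy, rfl⟩
    exact ⟨h * k, H.mul_mem hh hk, y, hy, by rw [mul_assoc]⟩
  · refine ⟨r '' insert 1 t, (ht.insert 1).image r, ?_⟩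
    rintro _ ⟨k, hk, y, hy, rfl⟩
    exact ⟨k, hk, _, ⟨y, hy, rfl⟩, rfl⟩
  · intro x hx
    obtain ⟨y, hy, hxy⟩ := hcov x
    obtain ⟨⟨k, hk, h, hh, e⟩, hry⟩ := hr y ⟨x, hx, hxy⟩
    obtain ⟨h', hh', m, n, e'⟩ := appr_trans hT hxy (appr_symm hry)
    refine ⟨(k * n - n) + m, h'⁻¹ * h ^ n, H.mul_mem (H.inv_mem hh') (H.pow_mem hh n), y, hy, ?_⟩
    have h1 : T^[m] x = h'⁻¹ * T^[n] (r y) := by rw [← e']; group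
    rw [Function.iterate_add_apply, h1, eqv_iter hT (H.inv_mem hh'), ← Function.iterate_add_apply,
      Nat.sub_add_cancel (Nat.le_mul_of_pos_left n hk), per_iter hT hh _ _ e, mul_assoc]

open Pointwise in
lemma flow_abs (hT : ∀ h ∈ H, ∀ x, T (h * x) = h * T x) (hBd : FinMod H Bd)
    (hedge : ∀ x l, x ∉ Bd → T x = x * lam l ∨ T (x * lam l) = x)
    (hind : ∀ C : P → Prop, C 1 → (∀ x l, C x → C (x * lam l)) → ∀ x, C x) :
    ∃ cl : P → Set P, (∀ h ∈ H, ∀ x, cl (h * x) = h • cl x) ∧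
      (∀ h ∈ H, ∀ x, h • cl x = cl x → h = 1) ∧
      ∀ y, FinMod H {x | cl (x * y) ≠ cl x} := by
  obtain ⟨R, hR, hRF, hper⟩ := exists_R hT hBd hedge hind
  have hR' : ∀ h ∈ H, ∀ x, h * x ∈ R ↔ x ∈ R := fun h hh x =>
    ⟨fun e => by simpa using hR _ (H.inv_mem hh) _ e, hR h hh x⟩
  set T' : P → P := fun x => if x ∈ R then x else T x with hT'
  have hTR : ∀ x ∈ R, T' x = x := fun x hx => by simp [hT', hx]
  have hTn : ∀ x ∉ R, T' x = T x := fun x hx => by simp [hT', hx]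
  have hE : ∀ h ∈ H, ∀ x, T' (h * x) = h * T' x := by
    intro h hh x
    by_cases hx : x ∈ R
    · rw [hTR x hx, hTR _ (hR h hh x hx)]
    · rw [hTn x hx, hTn _ (by rwa [hR' h hh]), hT h hh]
  set cl : P → Set P := fun x => {y | ∃ m n : ℕ, T'^[m] x = T'^[n] y} with hcl
  have hmem : ∀ x y, y ∈ cl x ↔ ∃ m n : ℕ, T'^[m] x = T'^[n] y := fun x y => Iff.rfl
  have hself : ∀ x, x ∈ cl x := fun x => ⟨0, 0, rfl⟩
  have hsub : ∀ x y, y ∈ cl x → cl y ⊆ cl x := by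
    rintro x y ⟨m, n, e⟩ z ⟨a, b, e'⟩
    refine ⟨a + m, n + b, ?_⟩
    rw [Function.iterate_add_apply, e, ← Function.iterate_add_apply, add_comm,
      Function.iterate_add_apply, e', ← Function.iterate_add_apply]
  have heq : ∀ x y, y ∈ cl x → cl y = cl x := by
    rintro x y h
    refine (hsub _ _ h).antisymm (hsub _ _ ?_)
    obtain ⟨m, n, e⟩ := h
    exact ⟨n, m, e.symm⟩
  have h1 : ∀ h ∈ H, ∀ x, cl (h * x) = h • cl x := by
    intro h hh x
    ext y
    rw [Set.mem_smul_set_iff_inv_smul_mem, smul_eq_mul, hmem, hmem]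
    refine exists_congr fun m => exists_congr fun n => ?_
    rw [eqv_iter hE hh, eqv_iter hE (H.inv_mem hh), eq_inv_mul_iff_mul_eq]
  have key : ∀ h ∈ H, ∀ y, ∀ k, T'^[k] y = h * y → h = 1 := by
    intro h hh y k e
    rcases Nat.eq_zero_or_pos k with rfl | hk
    · simpa using e
    by_cases hj : ∃ j, T'^[j] y ∈ R
    · obtain ⟨j, hj⟩ := hj
      have e1 : T'^[k] (T'^[j] y) = T'^[j] y := Function.iterate_fixed (hTR _ hj) k
      rw [← Function.iterate_add_apply, add_comm, Function.iterate_add_apply, e, eqv_iter hE hh] at e1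
      simpa using e1
    · push Not at hj
      have e2 : ∀ j, T^[j] y = T'^[j] y := by
        intro j
        induction j with
        | zero => rfl
        | succ j ih => rw [Function.iterate_succ_apply', Function.iterate_succ_apply', ih, hTn _ (hj j)]
      obtain ⟨j, h3⟩ := hper y ⟨k, hk, h, hh, by rw [e2, e]⟩
      rw [e2] at h3
      exact absurd h3 (hj j)
  refine ⟨cl, h1, ?_, ?_⟩
  · intro h hh x e
    rw [← h1 h hh] at e
    have h2 : h * x ∈ cl x := by rw [← e]; exact hself _
    obtain ⟨m, n, e⟩ := h2
    rw [eqv_iter hE hh] at e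
    rcases le_total n m with hnm | hnm
    · obtain ⟨k, rfl⟩ := Nat.exists_eq_add_of_le' hnm
      rw [Function.iterate_add_apply] at e
      exact key h hh _ k e
    · obtain ⟨k, rfl⟩ := Nat.exists_eq_add_of_le' hnm
      rw [Function.iterate_add_apply] at e
      have := key h⁻¹ (H.inv_mem hh) (T'^[m] x) k (by rw [eq_inv_mul_iff_mul_eq]; exact e.symm)
      simpa using this
  · refine hind _ ?_ ?_
    · exact ⟨∅, Set.finite_empty, by intro x hx; simp at hx⟩
    · intro y l hy
      have hl : FinMod H {x | cl (x * lam l) ≠ cl x} := by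
        refine ((hBd.union hRF).union (hRF.right (lam l))).mono ?_
        intro x hx
        by_contra hc
        simp only [Set.mem_union, Set.mem_setOf_eq, not_or] at hc
        obtain ⟨⟨hb, hr⟩, hrl⟩ := hc
        refine hx ?_
        rcases hedge x l hb with e | e
        · exact heq _ _ ⟨1, 0, by simp [hTn _ hr, e]⟩
        · exact heq _ _ ⟨0, 1, by simp [hTn _ hrl, e]⟩
      refine (hy.union (hl.right y)).mono ?_
      intro x hx
      by_contra hc
      simp only [Set.mem_union, Set.mem_setOf_eq, not_or, not_not] at hc
      apply hx
      rw [← mul_assoc, hc.2, hc.1]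
end flow
end fm

open Pointwise in
lemma flow {ι : Type*} [Finite ι] (θ : FreeGroup ι →* FreeGroup ι) (H : Subgroup (FreeGroup ι))
    (hH : ∀ x, x ∈ H ↔ θ x = x) :
    ∃ cl : FreeGroup ι → Set (FreeGroup ι), (∀ h ∈ H, ∀ x, cl (h * x) = h • cl x) ∧
      (∀ h ∈ H, ∀ x, h • cl x = cl x → h = 1) ∧
      ∀ y, FinMod H {x | cl (x * y) ≠ cl x} := by
  set q : FreeGroup ι → FreeGroup ι := fun x => x⁻¹ * θ x with hq
  have qh : ∀ h ∈ H, ∀ x, q (h * x) = q x := by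
    intro h hh x
    simp [hq, (hH h).1 hh, mul_assoc]
  have qq : ∀ x y, q x = q y → x * y⁻¹ ∈ H := by
    intro x y e
    rw [hH, map_mul, map_inv]
    simp only [hq] at e
    have : θ x = x * (y⁻¹ * θ y) := by rw [← e]; group
    rw [this]; group
  set T : FreeGroup ι → FreeGroup ι := fun x => ((q x).toWord.head?).elim x (fun l => x * lt1 l) with hTd
  obtain ⟨L, hL⟩ : ∃ L, ∀ l : ι × Bool, (θ (lt1 l)).norm ≤ L := by
    have := Fintype.ofFinite ι
    exact ⟨∑ l : ι × Bool, (θ (lt1 l)).norm, fun l =>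
      Finset.single_le_sum (f := fun l : ι × Bool => (θ (lt1 l)).norm) (fun _ _ => Nat.zero_le _)
        (Finset.mem_univ l)⟩
  refine flow_abs (T := T) (lam := lt1) (Bd := {x | (q x).norm ≤ L}) ?_ ?_ ?_ ?_
  · intro h hh x
    simp only [hTd, qh h hh]
    cases (q x).toWord.head? <;> simp [mul_assoc]
  · have hf : (q '' {x | (q x).norm ≤ L}).Finite :=
      (ball_fin L).subset (by rintro _ ⟨x, hx, rfl⟩; exact hx)
    obtain ⟨t, ht, hi⟩ := (Set.exists_subset_bijOn {x | (q x).norm ≤ L} q)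
    refine ⟨t, ?_, ?_⟩
    · exact Set.Finite.of_finite_image (by rw [hi.image_eq]; exact hf) hi.injOn
    · intro x hx
      obtain ⟨y, hy, e⟩ := hi.surjOn ⟨x, hx, rfl⟩
      exact ⟨x * y⁻¹, qq _ _ e.symm, y, hy, by group⟩
  · intro x l hx
    simp only [Set.mem_setOf_eq, not_le] at hx
    by_cases hl : (q x).toWord.head? = some l
    · left; simp [hTd, hl]
    · right
      have e : q (x * lt1 l) = ((lt1 l)⁻¹ * q x) * θ (lt1 l) := by simp [hq]; group
      have hw := word_cons (q x) l hl
      have h2 : (q (x * lt1 l)).toWord.head? = some (l.1, !l.2) := by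
        rw [e, word_head', hw]
        · simp
        · refine (hL l).trans_lt (hx.trans ?_)
          simp [FreeGroup.norm, hw]
      simp only [hTd, h2, Option.elim, ← lt1_inv]
      group
  · intro C h1 h2
    exact lt1_induct h1 h2
end S16
end
end

section
open Classical
noncomputable section
namespace S16

lemma orb_phi {H Y A : Type*} [Group H] [MulAction H Y] [Group A] (f : H →* A) :
    ∃ φ : Y → A, ∀ s, (∀ h : H, h • s = s → h = 1) → ∀ h : H, φ (h • s) = f h * φ s := by
  let r : Y → Y := fun s => (Quotient.mk (MulAction.orbitRel H Y) s).out
  have hr : ∀ s, ∃ k : H, k • r s = s := by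
    intro s
    have h1 : (MulAction.orbitRel H Y).r (r s) s := Quotient.exact (Quotient.out_eq _)
    have h2 := (MulAction.orbitRel H Y).symm h1
    exact h2
  have hrh : ∀ (h : H) s, r (h • s) = r s := by
    intro h s
    have : Quotient.mk (MulAction.orbitRel H Y) (h • s) = Quotient.mk (MulAction.orbitRel H Y) s :=
      Quotient.sound ⟨h, rfl⟩
    simp only [r, this]
  choose k hk using hr
  refine ⟨fun s => f (k s), fun s hs h => ?_⟩
  have e1 := hk (h • s)
  rw [hrh] at e1
  have e2 := hk s
  have e3 : r s = (k s)⁻¹ • s := by rw [eq_inv_smul_iff]; exact e2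
  have e4 : (h⁻¹ * k (h • s) * (k s)⁻¹) • s = s := by
    rw [mul_smul, ← e3, mul_smul, e1]; simp
  have e5 := hs _ e4
  have e6 : k (h • s) = h * k s := by
    rw [mul_inv_eq_one, inv_mul_eq_iff_eq_mul] at e5; exact e5
  simp only [e6, map_mul]

lemma sum_fix {X : Type*} {p : ℕ} [hp : Fact p.Prime] (G : X → ZMod p) (hG : G.support.Finite)
    (τ : X → X) (hτ : ∀ x, τ^[p] x = x) (hGτ : ∀ x, G (τ x) = G x) (c : X)
    (hc : ∀ x, τ x = x ↔ x = c) : ∑ᶠ x, G x = G c := by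
  have hcard : ∀ v : ZMod p, v ≠ 0 →
      (((hG.toFinset.filter (fun x => G x = v)).card : ℕ) : ZMod p) = if G c = v then 1 else 0 := by
    intro v hv
    have hmem : ∀ x, x ∈ hG.toFinset.filter (fun x => G x = v) ↔ G x = v := by
      intro x
      simp only [Finset.mem_filter, Set.Finite.mem_toFinset, Function.mem_support]
      exact ⟨fun h => h.2, fun h => ⟨h ▸ hv, h⟩⟩
    set s := hG.toFinset.filter (fun x => G x = v) with hs
    let σ : Function.End s := fun x => ⟨τ x.1, by rw [hmem, hGτ]; exact (hmem _).1 x.2⟩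
    have hσ : ∀ (n : ℕ) (x : s), ((σ ^ n) x : X) = τ^[n] x := by
      intro n
      induction n with
      | zero => intro x; rfl
      | succ n ih => intro x; rw [pow_succ, Function.iterate_succ_apply]; exact ih (σ x)
    have hσp : σ ^ p ^ 1 = 1 := by
      funext x
      apply Subtype.ext
      rw [hσ, pow_one, hτ]; rfl
    have := Equiv.Perm.card_fixedPoints_modEq hσp
    rw [Fintype.card_coe] at this
    rw [(ZMod.natCast_eq_natCast_iff _ _ _).2 this]
    split_ifs with hcv
    · have : Fintype.card (Function.fixedPoints σ) = 1 := by
        rw [Fintype.card_eq_one_iff]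
        refine ⟨⟨⟨c, (hmem _).2 hcv⟩, Subtype.ext ((hc c).2 rfl)⟩, ?_⟩
        rintro ⟨⟨x, hx⟩, h⟩
        have : τ x = x := congrArg Subtype.val h
        simp [(hc x).1 this]
      rw [this]; simp
    · have : Fintype.card (Function.fixedPoints σ) = 0 := by
        rw [Fintype.card_eq_zero_iff]
        refine ⟨?_⟩
        rintro ⟨⟨x, hx⟩, h⟩
        have : τ x = x := congrArg Subtype.val h
        rw [(hc x).1 this, hmem] at hx
        exact hcv hx
      rw [this]; simp
  rw [finsum_eq_sum_of_support_subset G (s := hG.toFinset) (by simp)]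
  rw [← Finset.sum_fiberwise (s := hG.toFinset) (g := G)]
  have : ∀ v : ZMod p, ∑ x ∈ hG.toFinset with G x = v, G x = if G c = v then v else 0 := by
    intro v
    rw [Finset.sum_congr rfl (g := fun _ => v) (by intro x hx; exact (Finset.mem_filter.1 hx).2)]
    rw [Finset.sum_const, nsmul_eq_mul]
    by_cases hv : v = 0
    · simp [hv]
    · rw [hcard v hv]; split_ifs <;> simp
  simp [this]

section smith
variable {ι : Type*} [Finite ι] {p : ℕ} [hp : Fact p.Prime] (θ : FreeGroup ι →* FreeGroup ι)
  (H : Subgroup (FreeGroup ι))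

lemma FinMod.theta {ι : Type*} {p : ℕ} (hp : p.Prime) {θ : FreeGroup ι →* FreeGroup ι} {H : Subgroup (FreeGroup ι)}
    (hH : ∀ x, x ∈ H ↔ θ x = x) (hθ : ∀ x, θ^[p] x = x) {A : Set (FreeGroup ι)}
    (hA : FinMod H A) : FinMod H {x | θ x ∈ A} := by
  obtain ⟨t, ht, hx⟩ := hA
  refine ⟨θ^[p-1] '' t, ht.image _, ?_⟩
  intro x h
  obtain ⟨h, hh, y, hy, e⟩ := hx _ h
  refine ⟨h, hh, _, ⟨y, hy, rfl⟩, ?_⟩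
  have h1 : θ^[p-1] (θ x) = x := by
    rw [← Function.iterate_succ_apply, Nat.succ_eq_add_one, Nat.sub_add_cancel hp.one_le, hθ]
  rw [← h1, e, iterate_map_mul, Function.iterate_fixed ((hH h).1 hh)]

open Pointwise in
lemma exists_F (hH : ∀ x, x ∈ H ↔ θ x = x) (hθ : ∀ x, θ^[p] x = x)
    (f : H →* Multiplicative (ZMod p)) :
    ∃ F : FreeGroup ι → ZMod p, (∀ (h : H) x, F (h * x) = (f h).toAdd + F x) ∧
      (∀ x, F (θ x) = F x) ∧ ∀ y, FinMod H {x | F (x * y) ≠ F x} := by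
  obtain ⟨cl, h1, h2, h3⟩ := flow θ H hH
  let S : FreeGroup ι → Set (Set (FreeGroup ι)) := fun x => Set.range (fun i : ℕ => cl (θ^[i] x))
  have hS1 : ∀ (h : H) x, S (h * x) = h • S x := by
    intro h x
    simp only [S]
    rw [Set.smul_set_range]
    congr 1
    funext i
    rw [iterate_map_mul, Function.iterate_fixed ((hH h).1 h.2), h1 _ h.2]
    rfl
  have hS2 : ∀ x, S (θ x) = S x := by
    intro x
    apply Set.Subset.antisymm
    · rintro _ ⟨i, rfl⟩; exact ⟨i + 1, rfl⟩
    · rintro _ ⟨i, rfl⟩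
      refine ⟨i + (p - 1), ?_⟩
      simp only
      rw [← Function.iterate_succ_apply, Nat.succ_eq_add_one, add_assoc, Nat.sub_add_cancel hp.out.one_le,
        Function.iterate_add_apply, hθ]
  have hmod : ∀ x i, θ^[i % p] x = θ^[i] x := fun x i =>
    Function.IsPeriodicPt.iterate_mod_apply (hθ x) i
  have hS3 : ∀ x, (S x).Finite := by
    intro x
    refine ((Set.finite_lt_nat p).image (fun i : ℕ => cl (θ^[i] x))).subset ?_
    rintro _ ⟨i, rfl⟩
    exact ⟨i % p, Nat.mod_lt _ hp.out.pos, by simp only [hmod]⟩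
  have hfree : ∀ x, ∀ h : H, h • S x = S x → h = 1 := by
    intro x h e
    have e' : ∀ n : ℕ, h ^ n • S x = S x := by
      intro n
      induction n with
      | zero => simp
      | succ n ih => rw [pow_succ, mul_smul, e, ih]
    have hin : ∀ n : ℕ, h ^ n • cl x ∈ S x := by
      intro n
      rw [← e' n]
      exact Set.smul_mem_smul_set ⟨0, rfl⟩
    obtain ⟨a, b, hab, hcl⟩ : ∃ a b : ℕ, a < b ∧ h ^ a • cl x = h ^ b • cl x := by
      have := (hS3 x).to_subtype
      obtain ⟨a, b, hne, hab⟩ := Finite.exists_ne_map_eq_of_infinite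
        (fun n : ℕ => (⟨h ^ n • cl x, hin n⟩ : S x))
      simp only [Subtype.mk.injEq] at hab
      rcases lt_or_gt_of_ne hne with hl | hl
      · exact ⟨a, b, hl, hab⟩
      · exact ⟨b, a, hl, hab.symm⟩
    obtain ⟨k, hk, rfl⟩ : ∃ k, k ≠ 0 ∧ b = a + k := ⟨b - a, by omega, by omega⟩
    rw [pow_add, mul_smul, smul_left_cancel_iff] at hcl
    have h4 := h2 _ (h ^ k).2 x hcl.symm
    have h5 : (h : FreeGroup ι) ^ k = 1 := by simpa using h4
    have h6 := (pow_eq_one_iff_left hk).1 h5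
    exact Subtype.ext h6
  obtain ⟨φ, hφ⟩ := orb_phi (Y := Set (Set (FreeGroup ι))) f
  refine ⟨fun x => (φ (S x)).toAdd, ?_, ?_, ?_⟩
  · intro h x
    simp only
    rw [hS1, hφ _ (hfree x)]; rfl
  · intro x; simp only [hS2]
  · intro y
    have hn : ∀ i : ℕ, ∀ y, FinMod H {x | cl (θ^[i] x * y) ≠ cl (θ^[i] x)} := by
      intro i
      induction i with
      | zero => exact h3
      | succ i ih => intro y; exact FinMod.theta hp.out hH hθ (ih y)
    have hn2 : ∀ n : ℕ, FinMod H {x | ∃ i < n, cl (θ^[i] (x * y)) ≠ cl (θ^[i] x)} := by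
      intro n
      induction n with
      | zero => exact ⟨∅, Set.finite_empty, by rintro x ⟨i, hi, _⟩; omega⟩
      | succ n ih =>
        refine (ih.union (hn n (θ^[n] y))).mono ?_
        rintro x ⟨i, hi, e⟩
        rcases Nat.lt_succ_iff_lt_or_eq.1 hi with h | rfl
        · left; exact ⟨i, h, e⟩
        · right; rw [iterate_map_mul] at e; exact e
    refine (hn2 p).mono ?_
    intro x hx
    by_contra hc
    simp only [Set.mem_setOf_eq] at hc
    push Not at hc
    apply hx
    have : S (x * y) = S x := by
      simp only [S]
      congr 1
      funext i
      rw [← hmod, ← hmod x, hc _ (Nat.mod_lt _ hp.out.pos)]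
    simp only [this]

lemma ext_hom (hH : ∀ x, x ∈ H ↔ θ x = x) (hθ : ∀ x, θ^[p] x = x)
    (f : H →* Multiplicative (ZMod p)) :
    ∃ f' : FreeGroup ι →* Multiplicative (ZMod p), ∀ x : H, f' x = f x := by
  obtain ⟨F, h1, h2, h3⟩ := exists_F θ H hH hθ f
  have h1' : ∀ h ∈ H, ∀ x y, F (h * x * y) - F (h * x) = F (x * y) - F x := by
    intro h hh x y
    rw [mul_assoc, h1 ⟨h, hh⟩, h1 ⟨h, hh⟩]; abel
  have hrel : ∀ x y, (QuotientGroup.rightRel H).r x y → ∃ h ∈ H, y = h * x := by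
    intro x y hxy
    have : y * x⁻¹ ∈ H := QuotientGroup.rightRel_apply.1 hxy
    exact ⟨_, this, by group⟩
  have hrel' : ∀ x, ∀ h ∈ H, (QuotientGroup.rightRel H).r x (h * x) := by
    intro x h hh
    refine QuotientGroup.rightRel_apply.2 ?_
    simpa using hh
  let X := Quotient (QuotientGroup.rightRel H)
  let G : FreeGroup ι → X → ZMod p := fun y => Quotient.lift (fun x => F (x * y) - F x) (by
    intro a b hab
    obtain ⟨h, hh, rfl⟩ := hrel a b hab
    exact (h1' h hh a y).symm)
  have hGs : ∀ y, (G y).support.Finite := by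
    intro y
    obtain ⟨t, ht, hx⟩ := h3 y
    refine (ht.image (Quotient.mk (QuotientGroup.rightRel H))).subset ?_
    intro a
    induction a using Quotient.inductionOn with
    | h x =>
      intro ha
      have : F (x * y) ≠ F x := by
        intro e; apply ha; simp [G, e]
      obtain ⟨h, hh, z, hz, rfl⟩ := hx x this
      exact ⟨z, hz, Quotient.sound (hrel' z h hh)⟩
  let ρ : FreeGroup ι → X → X := fun y => Quotient.map (fun x => x * y) (by
    intro a b hab
    obtain ⟨h, hh, rfl⟩ := hrel a b hab
    simp only [mul_assoc]
    exact hrel' _ h hh)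
  have hρ : ∀ y z, y * z = 1 → Function.LeftInverse (ρ z) (ρ y) := by
    intro y z e a
    induction a using Quotient.inductionOn with
    | h x => simp [ρ, mul_assoc, e]
  let E : FreeGroup ι → X ≃ X := fun y => ⟨ρ y, ρ y⁻¹, hρ _ _ (by simp), hρ _ _ (by simp)⟩
  have hadd : ∀ y z, ∑ᶠ a, G (y * z) a = ∑ᶠ a, G y a + ∑ᶠ a, G z a := by
    intro y z
    rw [← finsum_comp_equiv (E y) (f := G z), ← finsum_add_distrib (hGs y)]
    · congr 1
      funext a
      induction a using Quotient.inductionOn with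
      | h x => simp [G, E, ρ, mul_assoc]
    · have : Function.support (fun a => G z (E y a)) = (E y) ⁻¹' (G z).support := rfl
      change (Function.support (fun a => G z (E y a))).Finite
      rw [this]
      exact (hGs z).preimage (E y).injective.injOn
  refine ⟨MonoidHom.mk' (fun y => Multiplicative.ofAdd (∑ᶠ a, G y a)) ?_, ?_⟩
  · intro y z; rw [hadd]; rfl
  · intro y
    let τ : X → X := Quotient.map θ (by
      intro a b hab
      obtain ⟨h, hh, rfl⟩ := hrel a b hab
      rw [map_mul, (hH h).1 hh]
      exact hrel' _ h hh)
    have hτn : ∀ (n : ℕ) x, τ^[n] (Quotient.mk _ x) = Quotient.mk _ (θ^[n] x) := by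
      intro n
      induction n with
      | zero => intro x; rfl
      | succ n ih => intro x; rw [Function.iterate_succ_apply, Function.iterate_succ_apply, ← ih]; rfl
    have hs := sum_fix (G y) (hGs y) τ ?_ ?_ (Quotient.mk _ 1) ?_
    · change Multiplicative.ofAdd (∑ᶠ a, G y a) = f y
      rw [hs]
      have : G y (Quotient.mk _ 1) = (f y).toAdd := by
        have := h1 y 1
        rw [mul_one] at this
        simp [G, this]
      rw [this]; rfl
    · intro a
      induction a using Quotient.inductionOn with
      | h x => rw [hτn, hθ]
    · intro a
      induction a using Quotient.inductionOn with
      | h x =>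
        change F (θ x * y) - F (θ x) = F (x * y) - F x
        have : θ x * y = θ (x * y) := by rw [map_mul, (hH y).1 y.2]
        rw [this, h2, h2]
    · intro a
      induction a using Quotient.inductionOn with
      | h x =>
        constructor
        · intro e
          obtain ⟨h, hh, e⟩ := hrel _ _ (Quotient.exact e.symm)
          have hn : ∀ n : ℕ, θ^[n] x = h ^ n * x := by
            intro n
            induction n with
            | zero => simp
            | succ n ih =>
              rw [Function.iterate_succ_apply, e, iterate_map_mul, ih, Function.iterate_fixed ((hH h).1 hh),
                pow_succ', mul_assoc]
          have e2 := hn p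
          rw [hθ] at e2
          have e3 : h ^ p = 1 := by simpa using e2.symm
          have e4 : h = 1 := (pow_eq_one_iff_left hp.out.ne_zero).1 e3
          rw [e4, one_mul] at e
          have hx := (hH x).2 e
          symm
          apply Quotient.sound
          have := hrel' 1 x hx
          rwa [mul_one] at this
        · intro e
          obtain ⟨h, hh, rfl⟩ := hrel _ _ (Quotient.exact e.symm)
          change Quotient.mk _ (θ (h * 1)) = _
          rw [mul_one, (hH h).1 hh]
end smith
end S16
end
end

section
open Classical
noncomputable section
namespace S16

def FixRk (J : Type*) (m : ℕ) : Prop :=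
  ∀ θ : FreeGroup J →* FreeGroup J, (∀ x, θ^[m] x = x) →
    ∃ s : Finset (FreeGroup J), s.card ≤ Nat.card J ∧
      Subgroup.closure (s : Set (FreeGroup J)) = θ.eqLocus (MonoidHom.id _)

lemma transport {P : Type*} [Group P] (H : Subgroup P) {J : Type*} (B : FreeGroupBasis J H)
    (T : P →* P) (hTH : ∀ x ∈ H, T x ∈ H) (m : ℕ) (hm : ∀ x ∈ H, T^[m] x = x) (hJ : FixRk J m) :
    ∃ s : Finset P, s.card ≤ Nat.card J ∧
      ∀ x, x ∈ Subgroup.closure (s : Set P) ↔ x ∈ H ∧ T x = x := by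
  let TH : H →* H := (T.comp H.subtype).codRestrict H (fun x => hTH _ x.2)
  let θ : FreeGroup J →* FreeGroup J := (B.repr.toMonoidHom.comp TH).comp B.repr.symm.toMonoidHom
  have hθ : ∀ x, θ x = B.repr (TH (B.repr.symm x)) := fun x => rfl
  have hTn : ∀ (n : ℕ) (x : H), ((TH^[n] x : H) : P) = T^[n] x := by
    intro n
    induction n with
    | zero => intro x; rfl
    | succ n ih => intro x; rw [Function.iterate_succ_apply, Function.iterate_succ_apply, ih]; rfl
  have hθn : ∀ (n : ℕ) x, θ^[n] x = B.repr (TH^[n] (B.repr.symm x)) := by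
    intro n
    induction n with
    | zero => intro x; simp
    | succ n ih => intro x; rw [Function.iterate_succ_apply, Function.iterate_succ_apply, ih, hθ]; simp
  obtain ⟨s, hs, hc⟩ := hJ θ (by
    intro x
    rw [hθn]
    have : TH^[m] (B.repr.symm x) = B.repr.symm x := by
      apply Subtype.ext
      rw [hTn, hm _ (B.repr.symm x).2]
    rw [this]; simp)
  let i : FreeGroup J →* P := H.subtype.comp B.repr.symm.toMonoidHom
  refine ⟨s.image i, Finset.card_image_le.trans hs, ?_⟩
  intro x
  rw [Finset.coe_image, ← MonoidHom.map_closure, hc]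
  constructor
  · rintro ⟨y, hy, rfl⟩
    refine ⟨(B.repr.symm y).2, ?_⟩
    have hy' : θ y = y := hy
    rw [hθ] at hy'
    have : TH (B.repr.symm y) = B.repr.symm y := by
      apply B.repr.injective; rw [hy']; simp
    exact congrArg Subtype.val this
  · rintro ⟨hx, e⟩
    refine ⟨B.repr ⟨x, hx⟩, ?_, ?_⟩
    · change θ _ = _
      rw [hθ]
      have : TH ⟨x, hx⟩ = ⟨x, hx⟩ := Subtype.ext e
      simp [this]
    · simp [i]

lemma hom_coord {ι : Type*} [Fintype ι] {p : ℕ} (f : FreeGroup ι →* Multiplicative (ZMod p))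
    (w : FreeGroup ι) : (f w).toAdd = ∑ i, (f (FreeGroup.of i)).toAdd *
      (FreeGroup.lift (fun k => Multiplicative.ofAdd (if k = i then (1 : ZMod p) else 0)) w).toAdd := by
  induction w using FreeGroup.induction_on with
  | C1 => simp
  | of i => simp
  | inv_of i h => simp
  | mul a b ha hb => simp only [map_mul, toAdd_mul, mul_add, Finset.sum_add_distrib, ha, hb]

lemma rank_le {ι : Type*} [Finite ι] {p : ℕ} [hp : Fact p.Prime] {H : Subgroup (FreeGroup ι)}
    (hext : ∀ f : H →* Multiplicative (ZMod p),
      ∃ f' : FreeGroup ι →* Multiplicative (ZMod p), ∀ x : H, f' x = f x)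
    {J : Type*} (B : FreeGroupBasis J H) : Finite J ∧ Nat.card J ≤ Nat.card ι := by
  have := Fintype.ofFinite ι
  choose E hE using fun j : J => hext (B.lift (fun k => Multiplicative.ofAdd (if k = j then (1 : ZMod p) else 0)))
  have hli : LinearIndependent (ZMod p) (fun (j : J) (i : ι) => (E j (FreeGroup.of i)).toAdd) := by
    rw [linearIndependent_iff']
    intro s c hc k hk
    have h1 : ∑ j ∈ s, c j * (E j (B k)).toAdd = 0 := by
      rw [Finset.sum_congr rfl (fun j _ => by rw [hom_coord (E j) (B k)])]
      simp only [Finset.mul_sum]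
      rw [Finset.sum_comm]
      refine Finset.sum_eq_zero fun i _ => ?_
      have := congrFun hc i
      simp only [Finset.sum_apply, Pi.smul_apply, smul_eq_mul, Pi.zero_apply] at this
      simp only [← mul_assoc]
      rw [← Finset.sum_mul, this, zero_mul]
    simp only [hE] at h1
    simpa [hk] using h1
  have hfin : Finite J := hli.finite
  have := Fintype.ofFinite J
  refine ⟨hfin, ?_⟩
  have := hli.fintype_card_le_finrank
  simpa using this

lemma fixRk : ∀ (m : ℕ), 0 < m → ∀ (ι : Type) [Finite ι], FixRk ι m := by
  intro m
  induction m using induction_on_primes with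
  | zero => intro h; omega
  | one =>
    intro _ ι _ θ hθ
    have := Fintype.ofFinite ι
    refine ⟨Finset.univ.image FreeGroup.of, Finset.card_image_le.trans (by simp), ?_⟩
    rw [Finset.coe_image, Finset.coe_univ, Set.image_univ, FreeGroup.closure_range_of]
    ext x
    exact ⟨fun _ => hθ x, fun _ => Subgroup.mem_top x⟩
  | prime_mul p a hp ih =>
    intro hpa ι _ θ hθ
    have ha : 0 < a := Nat.pos_of_mul_pos_left hpa
    have := Fact.mk hp
    let ψ : FreeGroup ι →* FreeGroup ι := @HPow.hPow (Monoid.End (FreeGroup ι)) ℕ _ _ θ a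
    have hψ : ∀ x, ψ x = θ^[a] x := by
      intro x
      exact congrFun (Monoid.End.coe_pow _ (θ : Monoid.End (FreeGroup ι)) a) x
    have hψp : ∀ x, ψ^[p] x = x := by
      intro x
      have : (ψ : FreeGroup ι → FreeGroup ι) = θ^[a] := funext hψ
      rw [this, ← Function.iterate_mul, mul_comm, hθ]
    let H := ψ.eqLocus (MonoidHom.id _)
    have hH : ∀ x, x ∈ H ↔ ψ x = x := fun x => Iff.rfl
    let B := IsFreeGroup.basis H
    obtain ⟨hfin, hcard⟩ := rank_le (ext_hom ψ H hH hψp) B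
    obtain ⟨s, hs, hx⟩ := transport H B θ (by
      intro x hx
      rw [hH, hψ] at *
      rw [← Function.iterate_succ_apply, Function.iterate_succ_apply', hx]) a (by
      intro x hx
      rw [hH, hψ] at hx
      exact hx) (ih ha _)
    refine ⟨s, hs.trans hcard, ?_⟩
    ext x
    rw [hx]
    constructor
    · intro h; exact h.2
    · intro h
      refine ⟨?_, h⟩
      rw [hH, hψ]
      exact Function.iterate_fixed h a
end S16
end
end

section
open Classical
noncomputable section
namespace S16

lemma core {α κ : Type} [Fintype α] [Fintype κ] {g h : FreeGroup α →* FreeGroup κ}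
    {a b : FreeGroup κ →* FreeGroup α} (hag : ∀ x, a (g x) = x) (hbh : ∀ x, b (h x) = x)
    (htop : g.range ⊔ h.range = ⊤) (hne : g.range ≠ h.range) :
    ∃ s : Finset (FreeGroup α), s.card < Fintype.card α ∧
      Subgroup.closure (s : Set (FreeGroup α)) = g.eqLocus h := by
  let B := IsFreeGroup.basis (PP g h b)
  have hc := fun e => count hag hbh htop hne B e
  have hfin : Finite (IsFreeGroup.Generators (PP g h b)) := by
    by_contra hinf
    rw [not_finite_iff_infinite] at hinf
    exact hc ((Fintype.equivFin α).toEmbedding.trans (Fin.valEmbedding.trans (Infinite.natEmbedding _)))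
  have := Fintype.ofFinite (IsFreeGroup.Generators (PP g h b))
  have hlt : Fintype.card (IsFreeGroup.Generators (PP g h b)) < Fintype.card α := by
    by_contra hle
    push Not at hle
    obtain ⟨e⟩ := Function.Embedding.nonempty_of_card_le hle
    exact hc e
  let T : FreeGroup α →* FreeGroup α := b.comp g
  choose m hm0 hm using fun i => (mem_PP.1 (B i).2).2
  let M := ∏ i, m i
  have hM : 0 < M := Finset.prod_pos fun i _ => hm0 i
  have hper : ∀ x ∈ PP g h b, T^[M] x = x := by
    let ψ : FreeGroup α →* FreeGroup α := @HPow.hPow (Monoid.End (FreeGroup α)) ℕ _ _ T M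
    have hψ : ∀ x, ψ x = T^[M] x := fun x =>
      congrFun (Monoid.End.coe_pow _ (T : Monoid.End (FreeGroup α)) M) x
    have : ψ.comp (PP g h b).subtype = (PP g h b).subtype := by
      apply B.ext_hom
      intro i
      change ψ (B i) = B i
      rw [hψ]
      exact Function.IsPeriodicPt.trans_dvd (hm i) (Finset.dvd_prod_of_mem m (Finset.mem_univ i))
    intro x hx
    rw [← hψ]
    exact DFunLike.congr_fun this ⟨x, hx⟩
  obtain ⟨s, hs, hx⟩ := transport (PP g h b) B T (fun x hx => PP_step hx) M hper (fixRk M hM _)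
  rw [Nat.card_eq_fintype_card] at hs
  refine ⟨s, hs.trans_lt hlt, ?_⟩
  ext x
  rw [hx]
  constructor
  · rintro ⟨h1, h2⟩
    have := (mem_PP.1 h1).1 0
    simp only [Function.iterate_zero, id, zero_add, Function.iterate_one] at this
    have h3 : b.comp g x = x := h2
    rw [h3] at this
    exact this
  · intro e
    exact eqLocus_le_PP hbh e

theorem main {α β : Type} [Fintype α] (g h : FreeGroup α →* FreeGroup β)
    (hg : Function.Injective g) (hh : Function.Injective h)
    (K : Subgroup (FreeGroup β)) (hK : K = g.range ⊔ h.range) (ρ σ : K →* FreeGroup β)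
    (hρ : ∀ x, ρ x ∈ g.range) (hρ' : ∀ x : K, (x : FreeGroup β) ∈ g.range → ρ x = x)
    (hσ : ∀ x, σ x ∈ h.range) (hσ' : ∀ x : K, (x : FreeGroup β) ∈ h.range → σ x = x)
    (hne : g.range ≠ h.range) :
    ∃ s : Finset (FreeGroup α), s.card < Fintype.card α ∧
      Subgroup.closure (s : Set (FreeGroup α)) = g.eqLocus h := by
  let B := IsFreeGroup.basis K
  have hgK : ∀ x, g x ∈ K := fun x => hK ▸ (le_sup_left : g.range ≤ g.range ⊔ h.range) ⟨x, rfl⟩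
  have hhK : ∀ x, h x ∈ K := fun x => hK ▸ (le_sup_right : h.range ≤ g.range ⊔ h.range) ⟨x, rfl⟩
  let gK : FreeGroup α →* K := g.codRestrict K hgK
  let hK' : FreeGroup α →* K := h.codRestrict K hhK
  let g' := B.repr.toMonoidHom.comp gK
  let h' := B.repr.toMonoidHom.comp hK'
  let j := K.subtype.comp B.repr.symm.toMonoidHom
  have hj : Function.Injective j := K.subtype_injective.comp B.repr.symm.injective
  have hjg : j.comp g' = g := by ext x; simp [j, g', gK]
  have hjh : j.comp h' = h := by ext x; simp [j, h', hK']
  have hjr : (⊤ : Subgroup _).map j = K := by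
    rw [← MonoidHom.range_eq_map]
    ext x
    constructor
    · rintro ⟨y, rfl⟩; exact (B.repr.symm y).2
    · intro hx; exact ⟨B.repr ⟨x, hx⟩, by simp [j]⟩
  have hmg : g'.range.map j = g.range := by rw [MonoidHom.map_range, hjg]
  have hmh : h'.range.map j = h.range := by rw [MonoidHom.map_range, hjh]
  have htop : g'.range ⊔ h'.range = ⊤ := by
    apply Subgroup.map_injective hj
    rw [Subgroup.map_sup, hmg, hmh, hjr, hK]
  have hne' : g'.range ≠ h'.range := fun e => hne (by rw [← hmg, ← hmh, e])
  let a : FreeGroup (IsFreeGroup.Generators K) →* FreeGroup α :=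
    ((MonoidHom.ofInjective hg).symm.toMonoidHom.comp (ρ.codRestrict g.range hρ)).comp
      B.repr.symm.toMonoidHom
  let b : FreeGroup (IsFreeGroup.Generators K) →* FreeGroup α :=
    ((MonoidHom.ofInjective hh).symm.toMonoidHom.comp (σ.codRestrict h.range hσ)).comp
      B.repr.symm.toMonoidHom
  have hag : ∀ x, a (g' x) = x := by
    intro x
    change (MonoidHom.ofInjective hg).symm (ρ.codRestrict g.range hρ (B.repr.symm (B.repr (gK x)))) = x
    rw [MulEquiv.symm_apply_apply, MulEquiv.symm_apply_eq]
    apply Subtype.ext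
    exact hρ' _ ⟨x, rfl⟩
  have hbh : ∀ x, b (h' x) = x := by
    intro x
    change (MonoidHom.ofInjective hh).symm (σ.codRestrict h.range hσ (B.repr.symm (B.repr (hK' x)))) = x
    rw [MulEquiv.symm_apply_apply, MulEquiv.symm_apply_eq]
    apply Subtype.ext
    exact hσ' _ ⟨x, rfl⟩
  have hfin : Finite (IsFreeGroup.Generators K) := by
    let L : (IsFreeGroup.Generators K → Multiplicative (ZMod 2)) → (α → Multiplicative (ZMod 2)) × (α → Multiplicative (ZMod 2)) :=
      fun c => (fun i => FreeGroup.lift c (g' (FreeGroup.of i)), fun i => FreeGroup.lift c (h' (FreeGroup.of i)))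
    have hL : Function.Injective L := by
      intro c d e
      have e1 : (FreeGroup.lift c).comp g' = (FreeGroup.lift d).comp g' := by
        ext i
        exact congrArg Multiplicative.toAdd (congrFun (congrArg Prod.fst e) i)
      have e2 : (FreeGroup.lift c).comp h' = (FreeGroup.lift d).comp h' := by
        ext i
        exact congrArg Multiplicative.toAdd (congrFun (congrArg Prod.snd e) i)
      have h1 : g'.range ⊔ h'.range ≤ (FreeGroup.lift c).eqLocus (FreeGroup.lift d) := by
        apply sup_le
        · rintro _ ⟨x, rfl⟩; exact DFunLike.congr_fun e1 x
        · rintro _ ⟨x, rfl⟩; exact DFunLike.congr_fun e2 x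
      rw [htop] at h1
      funext k
      have : FreeGroup.lift c (FreeGroup.of k) = FreeGroup.lift d (FreeGroup.of k) :=
        h1 (Subgroup.mem_top (FreeGroup.of k))
      simpa using this
    have hF : Finite (IsFreeGroup.Generators K → Multiplicative (ZMod 2)) := Finite.of_injective L hL
    have hI : Function.Injective (fun (k : IsFreeGroup.Generators K) (k' : IsFreeGroup.Generators K) =>
        Multiplicative.ofAdd (if k' = k then (1 : ZMod 2) else 0)) := by
      intro k l e
      have := congrArg Multiplicative.toAdd (congrFun e k)
      by_contra hkl
      simp [hkl] at this
    exact Finite.of_injective _ hI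
  have := Fintype.ofFinite (IsFreeGroup.Generators K)
  obtain ⟨s, hs, hc⟩ := core hag hbh htop hne'
  refine ⟨s, hs, ?_⟩
  rw [hc]
  ext x
  constructor
  · intro e
    have e' : g' x = h' x := e
    change g x = h x
    rw [← hjg, ← hjh, MonoidHom.comp_apply, e']; rfl
  · intro e
    have e' : g x = h x := e
    change g' x = h' x
    apply hj
    rw [← hjg, ← hjh] at e'
    exact e'
end S16
end
end

/-- if `g, h : F(Σ) → F(Δ)` are injective homomorphisms of finitely
generated free groups, both `im g` and `im h` are retracts of `⟨im g ∪ im h⟩`, and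
`im g ≠ im h`, then `rk(Eq(g,h)) < |Σ|`. -/
theorem stmt_16 {α β : Type} [Fintype α] [Fintype β] (g h : FreeGroup α →* FreeGroup β)
    (hg : Function.Injective g) (hh : Function.Injective h)
    (hrg : IsRetractIn g.range (g.range ⊔ h.range))
    (hrh : IsRetractIn h.range (g.range ⊔ h.range))
    (hne : g.range ≠ h.range) :
    ∃ n, n < Fintype.card α ∧ rkLe (g.eqLocus h) n := by
  obtain ⟨ρ, hρ, hρ'⟩ := hrg
  obtain ⟨σ, hσ, hσ'⟩ := hrh
  obtain ⟨s, hs, hc⟩ := S16.main g h hg hh _ rfl ρ σ hρ hρ' hσ hσ' hne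
  exact ⟨s.card, hs, s, le_rfl, hc⟩
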